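/- Let k ≥ 1 be a fixed integer and p(n) = (log n + (k+1)·log log n − log log log n)/n. Then almost surely k ≤ κ₃(G(n, p(n))) ≤ λ₃(G(n, p(n))) ≤ k + 1. -/

import Mathlib

open Filter Asymptotics
open scoped Classical

noncomputable section

/-- The number of edges of a simple graph on a finite vertex type. -/
def edgeCount {V : Type*} [Fintype V] (G : SimpleGraph V) : ℕ :=
  G.edgeFinset.card

/-- Probability in the Erdős–Rényi model `G(n,p)` of a set `A` of graphs on `Fin n`:
each of the `n.choose 2` possible edges is present independently with probability `p`. -/
def gnpProb (n : ℕ) (p : ℝ) (A : Set (SimpleGraph (Fin n))) : ℝ :=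
  ∑ G ∈ Finset.univ.filter (fun G => G ∈ A),
    p ^ edgeCount G * (1 - p) ^ (n.choose 2 - edgeCount G)

/-- Probability in the uniform model `G(n,M)` of a set `A` of graphs on `Fin n`:
all graphs with exactly `M` edges are equally likely. -/
def gnmProb (n M : ℕ) (A : Set (SimpleGraph (Fin n))) : ℝ :=
  ((Finset.univ.filter (fun G : SimpleGraph (Fin n) => edgeCount G = M ∧ G ∈ A)).card : ℝ) /
    ((Finset.univ.filter (fun G : SimpleGraph (Fin n) => edgeCount G = M)).card : ℝ)

/-- `κ(S)`: the largest number of internally disjoint trees connecting `S`, i.e. trees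
`T₁, …, T_k` of `G` with `S ⊆ V(Tᵢ)`, `V(Tᵢ) ∩ V(Tⱼ) = S` and `E(Tᵢ) ∩ E(Tⱼ) = ∅`
for `i ≠ j`. -/
def kappaSet {V : Type*} (G : SimpleGraph V) (S : Set V) : ℕ :=
  sSup {k | ∃ T : Fin k → G.Subgraph,
    (∀ i, S ⊆ (T i).verts ∧ ((T i).coe).IsTree) ∧
    (∀ i j, i ≠ j → (T i).verts ∩ (T j).verts = S ∧
      (T i).edgeSet ∩ (T j).edgeSet = ∅)}

/-- `λ(S)`: the largest number of pairwise edge-disjoint trees of `G` each containing `S`. -/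
def lambdaSet {V : Type*} (G : SimpleGraph V) (S : Set V) : ℕ :=
  sSup {k | ∃ T : Fin k → G.Subgraph,
    (∀ i, S ⊆ (T i).verts ∧ ((T i).coe).IsTree) ∧
    (∀ i j, i ≠ j → (T i).edgeSet ∩ (T j).edgeSet = ∅)}

/-- The generalized `r`-connectivity `κ_r(G)`: the minimum of `κ(S)` over `r`-subsets `S`,
and `0` if `G` is disconnected. -/
def genKappa {V : Type*} [Fintype V] (r : ℕ) (G : SimpleGraph V) : ℕ :=
  if G.Connected then
    sInf {k | ∃ S : Finset V, S.card = r ∧ kappaSet G ↑S = k}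
  else 0

/-- The generalized `r`-edge-connectivity `λ_r(G)`: the minimum of `λ(S)` over
`r`-subsets `S`, and `0` if `G` is disconnected. -/
def genLambda {V : Type*} [Fintype V] (r : ℕ) (G : SimpleGraph V) : ℕ :=
  if G.Connected then
    sInf {k | ∃ S : Finset V, S.card = r ∧ lambdaSet G ↑S = k}
  else 0

/-- The vertex connectivity `κ(G)`: the largest `k` such that `G` is `k`-connected,
i.e. `k < |V|` and the removal of fewer than `k` vertices leaves a connected graph. -/
def vertexConnectivity {V : Type*} [Fintype V] (G : SimpleGraph V) : ℕ :=
  sSup {k | k < Fintype.card V ∧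
    ∀ S : Finset V, S.card < k → (G.induce ((↑S : Set V)ᶜ)).Connected}

/-- The edge connectivity `λ(G)`: the largest `k` such that removing fewer than `k`
edges always leaves a connected graph. -/
def edgeConnectivity {V : Type*} [Fintype V] (G : SimpleGraph V) : ℕ :=
  sSup {k | ∀ F : Finset (Sym2 V), F.card < k → (G.deleteEdges ↑F).Connected}

/-- The minimum degree `δ(G)`. -/
def minDeg {V : Type*} [Fintype V] (G : SimpleGraph V) : ℕ :=
  G.minDegree

/-- The number of children of `v` in the graph `H` viewed as rooted at `r`:
neighbours of `v` lying one step further from the root. -/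
def childCount {W : Type*} (H : SimpleGraph W) (r v : W) : ℕ :=
  {w | H.Adj v w ∧ H.dist r w = H.dist r v + 1}.ncard

/-- The depth of the graph `H` viewed as rooted at `r`: the largest distance from `r`. -/
def rootedDepth {W : Type*} (H : SimpleGraph W) (r : W) : ℕ :=
  sSup (Set.range (H.dist r))

/-- `T` is a subtree of `G` rooted at `r`, of depth `d`, in which every non-leaf
vertex has exactly `t` children (a `t`-ary tree of depth `d`). -/
def IsAryTreeOfDepth {V : Type*} {G : SimpleGraph V} (T : G.Subgraph) (r : V)
    (t d : ℕ) : Prop :=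
  ∃ hr : r ∈ T.verts,
    T.coe.IsTree ∧ rootedDepth T.coe ⟨r, hr⟩ = d ∧
      ∀ v : T.verts, childCount T.coe ⟨r, hr⟩ v = 0 ∨ childCount T.coe ⟨r, hr⟩ v = t

end

section Connectivity

variable {V : Type*}

/-- Families of trees as in the definition of `kappaSet` are families as in `lambdaSet`, and
in the latter every vertex of `S` has a different edge in every tree. -/
theorem treePacking_le_degree [Fintype V] {G : SimpleGraph V} {S : Set V} {v w : V} (hv : v ∈ S)
    (hw : w ∈ S) (hvw : v ≠ w) {m : ℕ} {T : Fin m → G.Subgraph}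
    (hT : ∀ i, S ⊆ (T i).verts ∧ ((T i).coe).IsTree)
    (hd : ∀ i j, i ≠ j → (T i).edgeSet ∩ (T j).edgeSet = ∅) : m ≤ G.degree v := by
  have key : ∀ i, ∃ x, (T i).Adj v x := by
    intro i
    obtain ⟨hS, ht⟩ := hT i
    have : Nontrivial (T i).verts := ⟨⟨v, hS hv⟩, ⟨w, hS hw⟩, by simpa using hvw⟩
    obtain ⟨x, hx⟩ := ht.connected.preconnected.exists_adj_of_nontrivial ⟨v, hS hv⟩
    exact ⟨x, hx⟩
  choose x hx using key
  have hinj : Function.Injective x := by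
    intro i j hij
    by_contra hne
    have h1 : s(v, x i) ∈ (T i).edgeSet ∩ (T j).edgeSet :=
      ⟨hx i, by rw [hij]; exact hx j⟩
    rw [hd i j hne] at h1
    exact h1
  rw [← SimpleGraph.card_neighborFinset_eq_degree]
  calc m = (Finset.univ.image x).card := by
        rw [Finset.card_image_of_injective _ hinj, Finset.card_univ, Fintype.card_fin]
    _ ≤ _ := Finset.card_le_card fun y hy => by
        obtain ⟨i, -, rfl⟩ := Finset.mem_image.1 hy
        simpa using (hx i).adj_sub

theorem exists_pair_of_card_three {S : Finset V} (hS : S.card = 3) (v : V) :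
    ∃ w ∈ S, v ≠ w := by
  by_contra! h
  have : S ⊆ {v} := fun w hw => by simp [h w hw]
  have := Finset.card_le_card this
  simp at this
  omega

theorem lambdaSet_le_degree [Fintype V] (G : SimpleGraph V) {S : Finset V} (hS : S.card = 3)
    {v : V} (hv : v ∈ S) : lambdaSet G ↑S ≤ G.degree v := by
  obtain ⟨w, hw, hvw⟩ := exists_pair_of_card_three hS v
  refine csSup_le' ?_
  rintro m ⟨T, hT, hd⟩
  exact treePacking_le_degree (S := ↑S) hv hw hvw hT hd

theorem bddAbove_lambdaSet [Fintype V] (G : SimpleGraph V) {S : Finset V} (hS : S.card = 3) :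
    BddAbove {k | ∃ T : Fin k → G.Subgraph,
      (∀ i, (S : Set V) ⊆ (T i).verts ∧ ((T i).coe).IsTree) ∧
      (∀ i j, i ≠ j → (T i).edgeSet ∩ (T j).edgeSet = ∅)} := by
  obtain ⟨v, hv⟩ : S.Nonempty := Finset.card_pos.1 (by omega)
  obtain ⟨w, hw, hvw⟩ := exists_pair_of_card_three hS v
  refine ⟨G.degree v, ?_⟩
  rintro m ⟨T, hT, hd⟩
  exact treePacking_le_degree (S := ↑S) hv hw hvw hT hd

theorem kappaSet_le_lambdaSet [Fintype V] (G : SimpleGraph V) {S : Finset V} (hS : S.card = 3) :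
    kappaSet G ↑S ≤ lambdaSet G ↑S := by
  refine csSup_le_csSup (bddAbove_lambdaSet G hS) ?_ ?_
  · exact ⟨0, Fin.elim0, fun i => i.elim0, fun i => i.elim0⟩
  · rintro m ⟨T, hT, hd⟩
    exact ⟨T, hT, fun i j hij => (hd i j hij).2⟩

theorem le_kappaSet [Fintype V] {G : SimpleGraph V} {S : Finset V} (hS : S.card = 3) {k : ℕ}
    (h : ∃ T : Fin k → G.Subgraph, (∀ i, (S : Set V) ⊆ (T i).verts ∧ ((T i).coe).IsTree) ∧
      (∀ i j, i ≠ j → (T i).verts ∩ (T j).verts = S ∧ (T i).edgeSet ∩ (T j).edgeSet = ∅)) :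
    k ≤ kappaSet G ↑S := by
  refine le_csSup ((bddAbove_lambdaSet G hS).mono ?_) h
  rintro m ⟨T, hT, hd⟩
  exact ⟨T, hT, fun i j hij => (hd i j hij).2⟩

theorem exists_card_three_mem [Fintype V] (hV : 3 ≤ Fintype.card V) (u v : V) :
    ∃ S : Finset V, S.card = 3 ∧ u ∈ S ∧ v ∈ S := by
  obtain ⟨S, hS, -, hc⟩ := Finset.exists_subsuperset_card_eq (Finset.subset_univ {u, v})
    (Finset.card_le_two.trans (by norm_num : 2 ≤ 3)) (by simpa using hV)
  exact ⟨S, hc, hS (by simp), hS (by simp)⟩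

theorem genKappa_le_genLambda [Fintype V] (hV : 3 ≤ Fintype.card V) (G : SimpleGraph V) :
    genKappa 3 G ≤ genLambda 3 G := by
  unfold genKappa genLambda
  split_ifs with hG
  · obtain ⟨v⟩ : Nonempty V := Fintype.card_pos_iff.1 (by omega)
    obtain ⟨S₀, h₀, -⟩ := exists_card_three_mem hV v v
    obtain ⟨S, hS, hl⟩ := Nat.sInf_mem (s := {k | ∃ S : Finset V, S.card = 3 ∧
      lambdaSet G ↑S = k}) ⟨_, S₀, h₀, rfl⟩
    rw [← hl]
    exact le_trans (Nat.sInf_le (Exists.intro S ⟨hS, rfl⟩)) (kappaSet_le_lambdaSet G hS)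
  · exact le_rfl

theorem genLambda_le_degree [Fintype V] (hV : 3 ≤ Fintype.card V) (G : SimpleGraph V) (v : V) :
    genLambda 3 G ≤ G.degree v := by
  unfold genLambda
  split_ifs with hG
  · obtain ⟨S, hS, hv, -⟩ := exists_card_three_mem hV v v
    exact le_trans (Nat.sInf_le (Exists.intro S ⟨hS, rfl⟩)) (lambdaSet_le_degree G hS hv)
  · exact Nat.zero_le _

theorem le_genKappa [Fintype V] (hV : 3 ≤ Fintype.card V) {G : SimpleGraph V} {k : ℕ}
    (hk : 1 ≤ k) (h : ∀ S : Finset V, S.card = 3 → ∃ T : Fin k → G.Subgraph,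
      (∀ i, (S : Set V) ⊆ (T i).verts ∧ ((T i).coe).IsTree) ∧
      (∀ i j, i ≠ j → (T i).verts ∩ (T j).verts = S ∧ (T i).edgeSet ∩ (T j).edgeSet = ∅)) :
    k ≤ genKappa 3 G := by
  obtain ⟨v₀⟩ : Nonempty V := Fintype.card_pos_iff.1 (by omega)
  have hG : G.Connected := by
    have : Nonempty V := ⟨v₀⟩
    refine ⟨fun u v => ?_⟩
    obtain ⟨S, hS, hu, hv⟩ := exists_card_three_mem hV u v
    obtain ⟨T, hT, -⟩ := h S hS
    obtain ⟨hS', ht⟩ := hT ⟨0, hk⟩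
    exact (ht.connected.preconnected ⟨u, hS' hu⟩ ⟨v, hS' hv⟩).map (T ⟨0, hk⟩).hom
  unfold genKappa
  rw [if_pos hG]
  obtain ⟨S₀, h₀, -⟩ := exists_card_three_mem hV v₀ v₀
  refine le_csInf ⟨_, S₀, h₀, rfl⟩ ?_
  rintro _ ⟨S, hS, rfl⟩
  exact le_kappaSet hS (h S hS)

/-- A connected induced subgraph of a subgraph of `G` has a spanning tree. -/
theorem exists_spanning_subtree {G H : SimpleGraph V} (hHG : H ≤ G) {A : Set V}
    (hA : (H.induce A).Connected) : ∃ T : G.Subgraph, T.verts = A ∧ T.coe.IsTree ∧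
      ∀ x y, T.Adj x y → H.Adj x y := by
  obtain ⟨F, hF, hFt⟩ := hA.exists_isTree_le
  let T : G.Subgraph :=
    { verts := A
      Adj := fun x y => ∃ hx hy, F.Adj ⟨x, hx⟩ ⟨y, hy⟩
      adj_sub := fun ⟨_, _, h⟩ => hHG (hF h)
      edge_vert := fun ⟨hx, _, _⟩ => hx
      symm := ⟨fun _ _ ⟨hx, hy, h⟩ => ⟨hy, hx, h.symm⟩⟩ }
  refine ⟨T, rfl, ?_, ?_⟩
  · have hTF : T.coe = F := by
      ext x y
      exact ⟨fun h => h.2.2, fun h => ⟨x.2, y.2, h⟩⟩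
    exact hTF ▸ hFt
  · rintro x y ⟨hx, hy, h⟩
    exact hF h

/-- The edges of `G` meeting `P` (all edges of `G` if `P` is empty). -/
def meetingGraph (G : SimpleGraph V) (P : Finset V) : SimpleGraph V where
  Adj x y := G.Adj x y ∧ (x ∈ P ∨ y ∈ P ∨ P = ∅)
  symm := ⟨fun x y h => ⟨h.1.symm, by tauto⟩⟩
  loopless := ⟨fun x h => h.1.ne rfl⟩

theorem exists_treePacking_of_parts {G : SimpleGraph V} {S : Finset V} {k : ℕ}
    (P : Fin k → Finset V) (hPS : ∀ i, Disjoint (P i) S)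
    (hd : ∀ i j, i ≠ j → Disjoint (P i) (P j)) (hne : ∀ i j, i ≠ j → P i = ∅ → P j ≠ ∅)
    (hc : ∀ i, ((meetingGraph G (P i)).induce ((P i ∪ S : Finset V) : Set V)).Connected) :
    ∃ T : Fin k → G.Subgraph, (∀ i, (S : Set V) ⊆ (T i).verts ∧ ((T i).coe).IsTree) ∧
      (∀ i j, i ≠ j → (T i).verts ∩ (T j).verts = S ∧ (T i).edgeSet ∩ (T j).edgeSet = ∅) := by
  choose T hTv hTt hTa using fun i =>
    exists_spanning_subtree (G := G) (H := meetingGraph G (P i)) (fun _ _ h => h.1) (hc i)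
  have hv : ∀ i j, i ≠ j → (T i).verts ∩ (T j).verts = S := by
    intro i j hij
    rw [hTv, hTv, ← Finset.coe_inter, ← Finset.inter_union_distrib_right,
      (Finset.disjoint_iff_inter_eq_empty.1 (hd i j hij)), Finset.empty_union]
  refine ⟨T, fun i => ⟨by rw [hTv]; simp, hTt i⟩, fun i j hij => ⟨hv i j hij, ?_⟩⟩
  rw [Set.eq_empty_iff_forall_notMem]
  refine Sym2.ind fun x y => ?_
  rintro ⟨h1, h2⟩
  rw [SimpleGraph.Subgraph.mem_edgeSet] at h1 h2
  have hx : x ∈ S := by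
    have : x ∈ (T i).verts ∩ (T j).verts := ⟨h1.fst_mem, h2.fst_mem⟩
    rwa [hv i j hij] at this
  have hy : y ∈ S := by
    have : y ∈ (T i).verts ∩ (T j).verts := ⟨h1.snd_mem, h2.snd_mem⟩
    rwa [hv i j hij] at this
  have key : ∀ l, (T l).Adj x y → P l = ∅ := by
    intro l hl
    rcases (hTa l x y hl).2 with h | h | h
    · exact absurd hx (Finset.disjoint_left.1 (hPS l) h)
    · exact absurd hy (Finset.disjoint_left.1 (hPS l) h)
    · exact h
  exact hne i j hij (key i h1) (key j h2)

theorem induce_connected_union_of_forall_adj {H : SimpleGraph V} {A S : Set V}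
    (hA : (H.induce A).Connected) (h : ∀ s ∈ S, ∃ a ∈ A, H.Adj a s) :
    (H.induce (A ∪ S)).Connected := by
  obtain ⟨a₀⟩ := hA.nonempty
  rw [SimpleGraph.connected_iff_exists_forall_reachable]
  have hr : ∀ a (ha : a ∈ A), (H.induce (A ∪ S)).Reachable ⟨a₀, Or.inl a₀.2⟩ ⟨a, Or.inl ha⟩ :=
    fun a ha => (hA.preconnected a₀ ⟨a, ha⟩).map
      (SimpleGraph.induceHomOfLE H Set.subset_union_left).toHom
  refine ⟨⟨a₀, Or.inl a₀.2⟩, ?_⟩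
  rintro ⟨w, hw | hw⟩
  · exact hr w hw
  · obtain ⟨a, ha, haw⟩ := h w hw
    refine (hr a ha).trans (SimpleGraph.Adj.reachable ?_)
    exact haw

theorem induce_connected_union_of_adj {H : SimpleGraph V} {A B : Set V}
    (hA : (H.induce A).Connected) (hB : (H.induce B).Connected) {a b : V} (ha : a ∈ A)
    (hb : b ∈ B) (hab : H.Adj a b) : (H.induce (A ∪ B)).Connected := by
  have h1 := induce_connected_union_of_forall_adj (S := {b}) hA
    (by rintro s rfl; exact ⟨a, ha, hab⟩)
  have h2 := SimpleGraph.induce_union_connected h1.preconnected hB.preconnected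
    ⟨b, Or.inr rfl, hb⟩
  rwa [Set.union_assoc, Set.union_eq_self_of_subset_left (Set.singleton_subset_iff.2 hb)] at h2

theorem connected_meetingGraph_of_connector {G : SimpleGraph V} {P S : Finset V}
    (hP : (G.induce (P : Set V)).Connected) (hS : ∀ x ∈ S, ∃ a ∈ P, G.Adj a x) :
    ((meetingGraph G P).induce ((P ∪ S : Finset V) : Set V)).Connected := by
  rw [Finset.coe_union]
  refine induce_connected_union_of_forall_adj ?_ ?_
  · refine hP.mono ?_
    intro x y hxy
    exact ⟨hxy, Or.inl x.2⟩
  · intro x hx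
    obtain ⟨a, ha, hax⟩ := hS x hx
    exact ⟨a, ha, hax, Or.inl ha⟩

end Connectivity

section Deterministic

variable {V : Type*} [Fintype V]

/-- The pairs of distinct vertices inside `U`. -/
noncomputable def pairsIn (U : Finset V) : Finset (Sym2 V) :=
  (⊤ : SimpleGraph V).edgeFinset.filter fun e => ∀ v ∈ e, v ∈ U

/-- The number of pairs in `F` that are edges of `G`. -/
noncomputable def edgesIn (G : SimpleGraph V) (F : Finset (Sym2 V)) : ℕ :=
  (F.filter (· ∈ G.edgeSet)).card

/-- The vertices outside `A` with a neighbour in `A`. -/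
noncomputable def outerBoundary (G : SimpleGraph V) (A : Finset V) : Finset V :=
  Finset.univ.filter fun v => v ∉ A ∧ ∃ a ∈ A, G.Adj a v

theorem mem_outerBoundary {G : SimpleGraph V} {A : Finset V} {v : V} :
    v ∈ outerBoundary G A ↔ v ∉ A ∧ ∃ a ∈ A, G.Adj a v := by
  simp [outerBoundary]

/-- The properties of the random graph that force many internally disjoint trees: vertices of
degree less than `D` are far apart, small sets are sparse, and large sets are joined. -/
structure IsPseudorandom (G : SimpleGraph V) (k D C s : ℕ) : Prop where
  le_degree : ∀ v, k + 1 ≤ G.degree v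
  not_adj : ∀ u v, u ≠ v → G.degree u < D → G.degree v < D → ¬ G.Adj u v
  no_common : ∀ u v w, u ≠ v → G.degree u < D → G.degree v < D → ¬ (G.Adj u w ∧ G.Adj w v)
  sparse : ∀ U : Finset V, U.Nonempty → U.card ≤ (C + 1) * s →
    2 * (C + 1) * edgesIn G (pairsIn U) < D * U.card
  joined : ∀ A B : Finset V, Disjoint A B → s ≤ A.card → s ≤ B.card →
    ∃ a ∈ A, ∃ b ∈ B, G.Adj a b

theorem sum_degree_le_two_mul_edgesIn (G : SimpleGraph V) {A U : Finset V} (hAU : A ⊆ U)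
    (hN : ∀ a ∈ A, ∀ v, G.Adj a v → v ∈ U) :
    ∑ a ∈ A, G.degree a ≤ 2 * edgesIn G (pairsIn U) := by
  set E := (pairsIn U).filter (· ∈ G.edgeSet) with hE
  have h1 : ∀ a ∈ A, G.degree a ≤ (E.filter fun e => a ∈ e).card := by
    intro a ha
    rw [← SimpleGraph.card_neighborFinset_eq_degree]
    refine Finset.card_le_card_of_injOn (fun v => s(a, v)) ?_ ?_
    · intro v hv
      have hav : G.Adj a v := by simpa using hv
      simp only [hE, pairsIn, Finset.coe_filter, Set.mem_ofPred_eq, Finset.mem_filter]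
      refine ⟨⟨⟨by simpa using hav.ne, ?_⟩, hav⟩, by simp⟩
      intro x hx
      rcases Sym2.mem_iff.1 hx with rfl | rfl
      · exact hAU ha
      · exact hN a ha _ hav
    · intro v _ w _ h
      exact Sym2.congr_right.1 h
  calc ∑ a ∈ A, G.degree a ≤ ∑ a ∈ A, (E.filter fun e => a ∈ e).card := Finset.sum_le_sum h1
    _ = ∑ e ∈ E, (A.filter fun a => a ∈ e).card :=
        Finset.sum_card_bipartiteAbove_eq_sum_card_bipartiteBelow _
    _ ≤ ∑ e ∈ E, 2 := by
        refine Finset.sum_le_sum fun e _ => ?_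
        induction e using Sym2.ind with
        | _ x y =>
          refine (Finset.card_le_card (t := {x, y}) ?_).trans Finset.card_le_two
          intro a ha
          simpa using (Finset.mem_filter.1 ha).2
    _ = 2 * edgesIn G (pairsIn U) := by simp [edgesIn, hE, mul_comm]

theorem IsPseudorandom.mul_card_le_card_outerBoundary {G : SimpleGraph V} {k D C s : ℕ}
    (h : IsPseudorandom G k D C s) {A : Finset V} (hA : A.Nonempty) (hs : A.card ≤ s)
    (hD : ∀ a ∈ A, D ≤ G.degree a) : C * A.card ≤ (outerBoundary G A).card := by
  by_contra! hlt
  have hcard : (A ∪ outerBoundary G A).card ≤ (C + 1) * A.card := by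
    refine (Finset.card_union_le _ _).trans ?_
    linarith
  have h1 := h.sparse (A ∪ outerBoundary G A) (hA.mono Finset.subset_union_left)
    (hcard.trans (Nat.mul_le_mul_left _ hs))
  have h2 := sum_degree_le_two_mul_edgesIn G (A := A) (U := A ∪ outerBoundary G A)
    Finset.subset_union_left (by
      intro a ha v hav
      rw [Finset.mem_union, mem_outerBoundary]
      by_cases hv : v ∈ A
      · exact Or.inl hv
      · exact Or.inr ⟨hv, a, ha, hav⟩)
  have h3 : A.card * D ≤ ∑ a ∈ A, G.degree a := by
    simpa using Finset.card_nsmul_le_sum A _ D hD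
  have h4 := Nat.mul_le_mul_left D hcard
  have h5 := Nat.mul_le_mul_left (C + 1) (h3.trans h2)
  nlinarith

/-- Disjoint connected sets grown from prescribed roots inside `Q`. -/
theorem exists_disjoint_connected_sets {ι : Type*} [Fintype ι] {G : SimpleGraph V}
    {Q : Finset V} {s : ℕ} (hexp : ∀ A ⊆ Q, A.Nonempty → A.card ≤ s →
      Fintype.card ι * (A.card + 1) < (outerBoundary G A ∩ Q).card)
    {r : ι → V} (hr : Function.Injective r) (hrQ : ∀ i, r i ∈ Q) {t : ℕ} (h1 : 1 ≤ t)
    (hts : t ≤ s) : ∃ X : ι → Finset V, (∀ i, r i ∈ X i ∧ X i ⊆ Q ∧ (X i).card = t ∧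
      (G.induce (X i : Set V)).Connected) ∧ ∀ i j, i ≠ j → Disjoint (X i) (X j) := by
  induction t, h1 using Nat.le_induction with
  | base =>
    refine ⟨fun i => {r i}, fun i => ⟨by simp, by simpa using hrQ i, by simp, ?_⟩, ?_⟩
    · rw [Finset.coe_singleton]
      exact SimpleGraph.Connected.of_subsingleton
    · intro i j hij
      simpa using fun h => hij (hr h)
  | succ t h1 ih =>
    obtain ⟨X, hX, hXd⟩ := ih (by omega)
    have step : ∀ J : Finset ι, ∃ Y : ι → Finset V, (∀ i, r i ∈ Y i ∧ Y i ⊆ Q ∧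
        (Y i).card = (if i ∈ J then t + 1 else t) ∧ (G.induce (Y i : Set V)).Connected) ∧
        ∀ i j, i ≠ j → Disjoint (Y i) (Y j) := by
      intro J
      induction J using Finset.induction_on with
      | empty => exact ⟨X, by simpa using hX, hXd⟩
      | insert j J hj ihJ =>
        obtain ⟨Y, hY, hYd⟩ := ihJ
        obtain ⟨hrj, hQj, hcj, hGj⟩ := hY j
        rw [if_neg hj] at hcj
        have hlt : (Finset.univ.biUnion Y).card < (outerBoundary G (Y j) ∩ Q).card := by
          refine lt_of_le_of_lt ?_ (hexp (Y j) hQj ⟨_, hrj⟩ (by omega))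
          refine Finset.card_biUnion_le.trans ?_
          refine (Finset.sum_le_card_nsmul _ _ (t + 1) fun i _ => ?_).trans ?_
          · rw [(hY i).2.2.1]
            split_ifs <;> omega
          · simp [hcj]
        obtain ⟨v, hv, hvY⟩ := Finset.exists_mem_notMem_of_card_lt_card hlt
        rw [Finset.mem_inter, mem_outerBoundary] at hv
        obtain ⟨⟨hvj, a, ha, hav⟩, hvQ⟩ := hv
        have hvY' : ∀ i, v ∉ Y i := by simpa using hvY
        refine ⟨Function.update Y j (insert v (Y j)), ?_, ?_⟩
        · intro i
          by_cases hij : i = j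
          · subst hij
            rw [Function.update_self]
            refine ⟨by simp [hrj], Finset.insert_subset hvQ hQj, ?_, ?_⟩
            · rw [Finset.card_insert_of_notMem hvj, hcj]
              simp
            · have := induce_connected_union_of_forall_adj (S := {v}) hGj
                (by rintro s rfl; exact ⟨a, ha, hav⟩)
              rwa [Finset.coe_insert, Set.insert_eq, Set.union_comm]
          · rw [Function.update_of_ne hij]
            simpa [Finset.mem_insert, hij] using hY i
        · intro i l hil
          by_cases hij : i = j
          · subst hij
            rw [Function.update_self, Function.update_of_ne (Ne.symm hil),
              Finset.disjoint_insert_left]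
            exact ⟨hvY' l, hYd _ _ hil⟩
          · by_cases hlj : l = j
            · subst hlj
              rw [Function.update_self, Function.update_of_ne hij,
                Finset.disjoint_insert_right]
              exact ⟨hvY' i, hYd _ _ hil⟩
            · rw [Function.update_of_ne hij, Function.update_of_ne hlj]
              exact hYd _ _ hil
    obtain ⟨Y, hY, hYd⟩ := step Finset.univ
    exact ⟨Y, by simpa using hY, hYd⟩

/-- The vertices of degree at least `D` outside `S`. -/
noncomputable def goodSet (G : SimpleGraph V) (D : ℕ) (S : Finset V) : Finset V :=
  Finset.univ.filter fun v => D ≤ G.degree v ∧ v ∉ S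

theorem mem_goodSet {G : SimpleGraph V} {D : ℕ} {S : Finset V} {v : V} :
    v ∈ goodSet G D S ↔ D ≤ G.degree v ∧ v ∉ S := by
  simp [goodSet]

theorem IsPseudorandom.eq_of_common {G : SimpleGraph V} {k D C s : ℕ}
    (h : IsPseudorandom G k D C s) {u v w : V} (hu : G.degree u < D) (hv : G.degree v < D)
    (huw : G.Adj w u) (hwv : G.Adj w v) : u = v := by
  by_contra hne
  exact h.no_common u v w hne hu hv ⟨huw.symm, hwv⟩

theorem IsPseudorandom.card_small_outerBoundary_le {G : SimpleGraph V} {k D C s : ℕ}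
    (h : IsPseudorandom G k D C s) (A : Finset V) :
    ((outerBoundary G A).filter fun v => G.degree v < D).card ≤ A.card := by
  have key : ∀ v ∈ (outerBoundary G A).filter (fun v => G.degree v < D), ∃ a ∈ A, G.Adj a v :=
    fun v hv => (mem_outerBoundary.1 (Finset.mem_filter.1 hv).1).2
  choose! f hf using key
  refine Finset.card_le_card_of_injOn f (fun v hv => (hf v hv).1) ?_
  intro u hu v hv huv
  refine h.eq_of_common (Finset.mem_filter.1 hu).2 (Finset.mem_filter.1 hv).2 (hf u hu).2 ?_
  rw [huv]
  exact (hf v hv).2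

theorem IsPseudorandom.expansion {G : SimpleGraph V} {k D C m s : ℕ}
    (h : IsPseudorandom G k D C s) (hC : 2 * m + 5 ≤ C) {S : Finset V} (hS : S.card = 3)
    {A : Finset V}
    (hAQ : A ⊆ goodSet G D S) (hA : A.Nonempty) (hs : A.card ≤ s) :
    m * (A.card + 1) < (outerBoundary G A ∩ goodSet G D S).card := by
  have h1 := h.mul_card_le_card_outerBoundary hA hs fun a ha => (mem_goodSet.1 (hAQ ha)).1
  have h2 := h.card_small_outerBoundary_le A
  have h3 : outerBoundary G A ⊆ (outerBoundary G A ∩ goodSet G D S) ∪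
      ((outerBoundary G A).filter (fun v => G.degree v < D) ∪ S) := by
    intro v hv
    simp only [Finset.mem_union, Finset.mem_inter, mem_goodSet, Finset.mem_filter, hv, true_and]
    by_cases hvS : v ∈ S
    · exact Or.inr (Or.inr hvS)
    · rcases lt_or_ge (G.degree v) D with hd | hd
      · exact Or.inr (Or.inl hd)
      · exact Or.inl ⟨hd, hvS⟩
  have h4 := (Finset.card_le_card h3).trans ((Finset.card_union_le _ _).trans
    (Nat.add_le_add_left (Finset.card_union_le _ _) _))
  have h5 : 1 ≤ A.card := hA.card_pos
  have h6 := Nat.mul_le_mul_right A.card hC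
  nlinarith

/-- Distinct good neighbours for the vertices of `S`, by Hall's theorem. -/
theorem IsPseudorandom.exists_roots {G : SimpleGraph V} {k D C s l : ℕ}
    (h : IsPseudorandom G k D C s) (hD : 3 * l + 4 ≤ D) {S : Finset V} (hS : S.card = 3)
    (hl : ∀ x ∈ S, G.degree x < D → l ≤ (G.neighborFinset x ∩ goodSet G D S).card) :
    ∃ r : S × Fin l → V, Function.Injective r ∧
      ∀ p, r p ∈ goodSet G D S ∧ G.Adj p.1 (r p) := by
  have hall := (Finset.all_card_le_biUnion_card_iff_exists_injective
    (fun p : S × Fin l => G.neighborFinset p.1 ∩ goodSet G D S)).1 ?_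
  · obtain ⟨r, hr, hr'⟩ := hall
    refine ⟨r, hr, fun p => ?_⟩
    have := hr' p
    rw [Finset.mem_inter, SimpleGraph.mem_neighborFinset] at this
    exact ⟨this.2, this.1⟩
  intro J
  set K := J.image Prod.fst with hK
  have hJ : J.card ≤ K.card * l := by
    calc J.card ≤ (K ×ˢ (Finset.univ : Finset (Fin l))).card := Finset.card_le_card fun p hp =>
          Finset.mem_product.2 ⟨Finset.mem_image_of_mem _ hp, Finset.mem_univ _⟩
      _ = K.card * l := by simp
  have hbi : (J.biUnion fun p => G.neighborFinset p.1 ∩ goodSet G D S) =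
      K.biUnion fun x => G.neighborFinset x ∩ goodSet G D S := by
    rw [hK, Finset.image_biUnion]
  rw [hbi]
  refine hJ.trans ?_
  by_cases hsm : ∀ x ∈ K, G.degree (x : V) < D
  · rw [Finset.card_biUnion]
    · simpa using Finset.card_nsmul_le_sum K _ l fun x hx => hl x x.2 (hsm x hx)
    · intro x hx y hy hxy
      refine Finset.disjoint_left.2 ?_
      intro v hvx hvy
      rw [Finset.mem_inter, SimpleGraph.mem_neighborFinset] at hvx hvy
      exact hxy (Subtype.ext (h.eq_of_common (hsm x hx) (hsm y hy) hvx.1.symm hvy.1.symm))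
  · push Not at hsm
    obtain ⟨x, hxK, hx⟩ := hsm
    have hK3 : K.card ≤ 3 := by
      simpa [hS] using Finset.card_le_univ K
    have h1 : ((G.neighborFinset x).filter fun v => G.degree v < D).card ≤ 1 := by
      rw [Finset.card_le_one]
      intro u hu v hv
      rw [Finset.mem_filter, SimpleGraph.mem_neighborFinset] at hu hv
      exact h.eq_of_common hu.2 hv.2 hu.1 hv.1
    have h2 : G.neighborFinset x ⊆ (G.neighborFinset x ∩ goodSet G D S) ∪
        ((G.neighborFinset x).filter (fun v => G.degree v < D) ∪ S) := by
      intro v hv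
      simp only [Finset.mem_union, Finset.mem_inter, mem_goodSet, Finset.mem_filter, hv, true_and]
      by_cases hvS : v ∈ S
      · exact Or.inr (Or.inr hvS)
      · rcases lt_or_ge (G.degree v) D with hd | hd
        · exact Or.inr (Or.inl hd)
        · exact Or.inl ⟨hd, hvS⟩
    have h3 := (Finset.card_le_card h2).trans ((Finset.card_union_le _ _).trans
      (Nat.add_le_add_left (Finset.card_union_le _ _) _))
    rw [SimpleGraph.card_neighborFinset_eq_degree] at h3
    have h4 : (G.neighborFinset x ∩ goodSet G D S).card ≤
        (K.biUnion fun x => G.neighborFinset (x : V) ∩ goodSet G D S).card :=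
      Finset.card_le_card
        (Finset.subset_biUnion_of_mem (fun x : S => G.neighborFinset (x : V) ∩ goodSet G D S) hxK)
    have h5 := Nat.mul_le_mul_right l hK3
    omega

/-- Disjoint connected sets, each containing a neighbour of every vertex of `S`. -/
theorem IsPseudorandom.exists_connectors {G : SimpleGraph V} {k D C s l : ℕ}
    (h : IsPseudorandom G k D C s) (hC : 6 * l + 5 ≤ C) (hs : 1 ≤ s) {S : Finset V}
    (hS : S.card = 3) {r : S × Fin l → V} (hr : Function.Injective r)
    (hrS : ∀ p, r p ∈ goodSet G D S ∧ G.Adj p.1 (r p)) :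
    ∃ P : Fin l → Finset V, (∀ i, (P i).Nonempty) ∧ (∀ i, Disjoint (P i) S) ∧
      (∀ i j, i ≠ j → Disjoint (P i) (P j)) ∧ (∀ i, (G.induce (P i : Set V)).Connected) ∧
      ∀ i, ∀ x ∈ S, ∃ a ∈ P i, G.Adj a x := by
  have hcard : Fintype.card (S × Fin l) = 3 * l := by simp [hS]
  obtain ⟨X, hX, hXd⟩ := exists_disjoint_connected_sets (G := G) (Q := goodSet G D S) (s := s)
    (fun A hAQ hA hAs => by rw [hcard]; exact h.expansion (by omega) hS hAQ hA hAs) hr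
    (fun p => (hrS p).1) hs le_rfl
  obtain ⟨x₀, hx₀⟩ : S.Nonempty := Finset.card_pos.1 (by omega)
  have hmem : ∀ {i : Fin l} {v : V},
      v ∈ (Finset.univ.biUnion fun x : S => X (x, i)) ↔ ∃ x : S, v ∈ X (x, i) := by simp
  have hne : ∀ i : Fin l, r (⟨x₀, hx₀⟩, i) ∈ Finset.univ.biUnion fun x : S => X (x, i) :=
    fun i => hmem.2 ⟨_, (hX _).1⟩
  refine ⟨fun i => Finset.univ.biUnion fun x : S => X (x, i), fun i => ⟨_, hne i⟩, ?_, ?_, ?_, ?_⟩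
  · intro i
    rw [Finset.disjoint_left]
    intro v hv
    obtain ⟨x, hx⟩ := hmem.1 hv
    exact (mem_goodSet.1 ((hX (x, i)).2.1 hx)).2
  · intro i j hij
    rw [Finset.disjoint_left]
    intro v hv hv'
    obtain ⟨x, hx⟩ := hmem.1 hv
    obtain ⟨y, hy⟩ := hmem.1 hv'
    exact Finset.disjoint_left.1 (hXd (x, i) (y, j) fun e => hij (congrArg Prod.snd e)) hx hy
  · intro i
    have hunion : ∀ x : S, (G.induce ((X (⟨x₀, hx₀⟩, i) : Set V) ∪ X (x, i))).Connected := by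
      intro x
      by_cases hx : x = ⟨x₀, hx₀⟩
      · subst hx
        rw [Set.union_self]
        exact (hX _).2.2.2
      · obtain ⟨a, ha, b, hb, hab⟩ := h.joined _ _
          (hXd (⟨x₀, hx₀⟩, i) (x, i) fun e => hx (congrArg Prod.fst e).symm)
          (hX _).2.2.1.ge (hX _).2.2.1.ge
        exact induce_connected_union_of_adj (hX _).2.2.2 (hX _).2.2.2 ha hb hab
    refine SimpleGraph.induce_connected_of_patches _ (hne i) ?_
    intro v hv
    obtain ⟨x, hx⟩ := hmem.1 hv
    refine ⟨(X (⟨x₀, hx₀⟩, i) : Set V) ∪ X (x, i), ?_, Or.inl (hX _).1, Or.inr hx,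
      (hunion x).preconnected _ _⟩
    rintro w (hw | hw)
    · exact hmem.2 ⟨_, hw⟩
    · exact hmem.2 ⟨_, hw⟩
  · intro i x hx
    exact ⟨r (⟨x, hx⟩, i), hmem.2 ⟨_, (hX _).1⟩, (hrS (⟨x, hx⟩, i)).2.symm⟩

theorem IsPseudorandom.exists_connectors_of_le {G : SimpleGraph V} {k D C s l : ℕ}
    (h : IsPseudorandom G k D C s) (hC : 6 * l + 5 ≤ C) (hs : 1 ≤ s)
    (hD : 3 * l + 4 ≤ D) {S : Finset V} (hS : S.card = 3)
    (hl : ∀ x ∈ S, G.degree x < D → l ≤ (G.neighborFinset x ∩ goodSet G D S).card) :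
    ∃ P : Fin l → Finset V, (∀ i, (P i).Nonempty) ∧ (∀ i, Disjoint (P i) S) ∧
      (∀ i j, i ≠ j → Disjoint (P i) (P j)) ∧ (∀ i, ((meetingGraph G (P i)).induce
        ((P i ∪ S : Finset V) : Set V)).Connected) := by
  obtain ⟨r, hr, hrS⟩ := h.exists_roots hD hS hl
  obtain ⟨P, h1, h2, h3, h4, h5⟩ := h.exists_connectors hC hs hS hr hrS
  exact ⟨P, h1, h2, h3, fun i => connected_meetingGraph_of_connector (h4 i) (h5 i)⟩

theorem IsPseudorandom.degree_le_of_small {G : SimpleGraph V} {k D C s : ℕ}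
    (h : IsPseudorandom G k D C s) {S : Finset V} {x : V} (hx : G.degree x < D) :
    k + 1 ≤ (G.neighborFinset x ∩ goodSet G D S).card + (G.neighborFinset x ∩ S).card := by
  refine (h.le_degree x).trans ?_
  rw [← SimpleGraph.card_neighborFinset_eq_degree]
  refine (Finset.card_le_card ?_).trans (Finset.card_union_le _ _)
  intro v hv
  have hxv : G.Adj x v := by simpa using hv
  simp only [Finset.mem_union, Finset.mem_inter, mem_goodSet, hv, true_and]
  by_cases hvS : v ∈ S
  · exact Or.inr hvS
  · refine Or.inl ⟨?_, hvS⟩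
    by_contra! hd
    exact h.not_adj x v hxv.ne hx hd hxv

theorem IsPseudorandom.exists_treePacking {G : SimpleGraph V} {k D C s : ℕ} (hk : 1 ≤ k)
    (h : IsPseudorandom G k D C s) (hC : 6 * k + 5 ≤ C) (hs : 1 ≤ s) (hD : 3 * k + 4 ≤ D)
    {S : Finset V} (hS : S.card = 3) :
    ∃ T : Fin k → G.Subgraph, (∀ i, (S : Set V) ⊆ (T i).verts ∧ ((T i).coe).IsTree) ∧
      (∀ i j, i ≠ j → (T i).verts ∩ (T j).verts = S ∧ (T i).edgeSet ∩ (T j).edgeSet = ∅) := by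
  by_cases hcase : ∃ x ∈ S, G.degree x < D ∧ ∀ y ∈ S, y ≠ x → G.Adj x y
  · obtain ⟨l, rfl⟩ : ∃ l, k = l + 1 := ⟨k - 1, by omega⟩
    obtain ⟨x₀, hx₀, -, hadj⟩ := hcase
    have hl : ∀ x ∈ S, G.degree x < D → l ≤ (G.neighborFinset x ∩ goodSet G D S).card := by
      intro x hx hxD
      have h5 := h.degree_le_of_small (S := S) hxD
      have h6 : (G.neighborFinset x ∩ S).card ≤ (S.erase x).card := Finset.card_le_card
        fun v hv => by
          rw [Finset.mem_inter, SimpleGraph.mem_neighborFinset] at hv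
          exact Finset.mem_erase.2 ⟨hv.1.ne', hv.2⟩
      rw [Finset.card_erase_of_mem hx, hS] at h6
      omega
    obtain ⟨P, h1, h2, h3, h4⟩ := h.exists_connectors_of_le (by omega) hs (by omega) hS hl
    refine exists_treePacking_of_parts (Fin.cons ∅ P) ?_ ?_ ?_ ?_
    · refine Fin.cases ?_ ?_
      · simp
      · simpa using h2
    · refine Fin.cases ?_ fun i => ?_
      · simp
      · refine Fin.cases ?_ fun j => ?_
        · simp
        · simpa using h3 i j
    · refine Fin.cases ?_ fun i => ?_
      · refine Fin.cases ?_ fun j => ?_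
        · simp
        · exact fun _ _ => (h1 j).ne_empty
      · intro j _ hi
        exact absurd hi (by simpa using (h1 i).ne_empty)
    · refine Fin.cases ?_ ?_
      · rw [Fin.cons_zero, Finset.empty_union, SimpleGraph.connected_iff_exists_forall_reachable]
        refine ⟨⟨x₀, hx₀⟩, fun w => ?_⟩
        by_cases hw : (w : V) = x₀
        · rw [show w = ⟨x₀, hx₀⟩ from Subtype.ext hw]
        · refine SimpleGraph.Adj.reachable ?_
          exact ⟨hadj w w.2 hw, Or.inr (Or.inr rfl)⟩
      · exact h4
  · push Not at hcase
    have hl : ∀ x ∈ S, G.degree x < D → k ≤ (G.neighborFinset x ∩ goodSet G D S).card := by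
      intro x hx hxD
      have h5 := h.degree_le_of_small (S := S) hxD
      obtain ⟨y, hy, hyx, hxy⟩ := hcase x hx hxD
      have h6 : (G.neighborFinset x ∩ S).card ≤ ((S.erase x).erase y).card := Finset.card_le_card
        fun v hv => by
          rw [Finset.mem_inter, SimpleGraph.mem_neighborFinset] at hv
          refine Finset.mem_erase.2 ⟨?_, Finset.mem_erase.2 ⟨hv.1.ne', hv.2⟩⟩
          rintro rfl
          exact hxy hv.1
      rw [Finset.card_erase_of_mem (Finset.mem_erase.2 ⟨hyx, hy⟩), Finset.card_erase_of_mem hx,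
        hS] at h6
      omega
    obtain ⟨P, h1, h2, h3, h4⟩ := h.exists_connectors_of_le hC hs hD hS hl
    exact exists_treePacking_of_parts P h2 h3 (fun i j _ _ => (h1 j).ne_empty) h4

theorem IsPseudorandom.le_genKappa {G : SimpleGraph V} {k D C s : ℕ} (hV : 3 ≤ Fintype.card V)
    (hk : 1 ≤ k) (h : IsPseudorandom G k D C s) (hC : 6 * k + 5 ≤ C) (hs : 1 ≤ s)
    (hD : 3 * k + 4 ≤ D) : k ≤ genKappa 3 G :=
  _root_.le_genKappa hV hk fun _ hS => h.exists_treePacking hk hC hs hD hS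

end Deterministic

section Expectation

variable {V : Type*} [Fintype V]

/-- The probability of `G` in the binomial random graph on the vertex set `V`. -/
noncomputable def graphWeight (p : ℝ) (G : SimpleGraph V) : ℝ :=
  p ^ edgeCount G * (1 - p) ^ ((Fintype.card V).choose 2 - edgeCount G)

/-- Expectation over the binomial random graph on the vertex set `V`. -/
noncomputable def graphExp (p : ℝ) (f : SimpleGraph V → ℝ) : ℝ :=
  ∑ G, graphWeight p G * f G

theorem edgeFinset_top_card :
    (⊤ : SimpleGraph V).edgeFinset.card = (Fintype.card V).choose 2 := by
  rw [← SimpleGraph.card_edgeFinset_top_eq_card_choose_two]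

theorem sum_simpleGraph_eq_sum_powerset (φ : Finset (Sym2 V) → ℝ) :
    ∑ G : SimpleGraph V, φ ((⊤ : SimpleGraph V).edgeFinset.filter (· ∈ G.edgeSet)) =
      ∑ t ∈ (⊤ : SimpleGraph V).edgeFinset.powerset, φ t := by
  refine Finset.sum_bij'
    (i := fun G _ => (⊤ : SimpleGraph V).edgeFinset.filter (· ∈ G.edgeSet))
    (j := fun t _ => SimpleGraph.fromEdgeSet (t : Set (Sym2 V))) ?_ ?_ ?_ ?_ ?_
  · intro G _
    exact Finset.mem_powerset.2 (Finset.filter_subset _ _)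
  · intro t _
    exact Finset.mem_univ _
  · intro G _
    ext x y
    simp only [SimpleGraph.fromEdgeSet_adj, Finset.coe_filter, Set.mem_ofPred_eq,
      SimpleGraph.mem_edgeFinset, SimpleGraph.mem_edgeSet, SimpleGraph.top_adj]
    exact ⟨fun h => h.1.2, fun h => ⟨⟨h.ne, h⟩, h.ne⟩⟩
  · intro t ht
    ext e
    have := Finset.mem_powerset.1 ht
    simp only [Finset.mem_filter, SimpleGraph.edgeSet_fromEdgeSet, Set.mem_sdiff, Finset.mem_coe]
    constructor
    · exact fun h => h.2.1
    · intro h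
      refine ⟨this h, h, ?_⟩
      have h2 := SimpleGraph.mem_edgeFinset.1 (this h)
      exact (SimpleGraph.not_isDiag_of_mem_edgeSet _ h2)
  · intro G _
    rfl

theorem filter_top_edgeFinset (G : SimpleGraph V) :
    (⊤ : SimpleGraph V).edgeFinset.filter (· ∈ G.edgeSet) = G.edgeFinset := by
  ext e
  simp only [Finset.mem_filter, SimpleGraph.mem_edgeFinset, and_iff_right_iff_imp]
  exact fun h => SimpleGraph.edgeSet_mono le_top h

theorem graphExp_prod (p : ℝ) (a b : Sym2 V → ℝ) :
    graphExp p (fun G : SimpleGraph V => ∏ e ∈ (⊤ : SimpleGraph V).edgeFinset,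
      if e ∈ G.edgeSet then a e else b e) =
      ∏ e ∈ (⊤ : SimpleGraph V).edgeFinset, (p * a e + (1 - p) * b e) := by
  rw [Finset.prod_add, ← sum_simpleGraph_eq_sum_powerset]
  refine Finset.sum_congr rfl fun G _ => ?_
  have h := Finset.card_filter_add_card_filter_not (s := (⊤ : SimpleGraph V).edgeFinset)
    (fun e => e ∈ G.edgeSet)
  rw [edgeFinset_top_card] at h
  have hE : edgeCount G = ((⊤ : SimpleGraph V).edgeFinset.filter (· ∈ G.edgeSet)).card := by
    rw [filter_top_edgeFinset, edgeCount]
  beta_reduce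
  rw [Finset.prod_ite, ← Finset.filter_not, Finset.prod_mul_distrib, Finset.prod_mul_distrib,
    Finset.prod_const, Finset.prod_const, graphWeight, hE, ← h, Nat.add_sub_cancel_left]
  ring

/-- The indicator of the event that all pairs in `F` are edges. -/
noncomputable def containsInd (F : Finset (Sym2 V)) (G : SimpleGraph V) : ℝ :=
  if ∀ e ∈ F, e ∈ G.edgeSet then 1 else 0

theorem containsInd_mul_pow_eq_prod (F₁ : Finset (Sym2 V)) {F₂ : Finset (Sym2 V)}
    (h₁ : F₁ ⊆ (⊤ : SimpleGraph V).edgeFinset) (h₂ : F₂ ⊆ (⊤ : SimpleGraph V).edgeFinset)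
    (x : ℝ) (G : SimpleGraph V) :
    containsInd F₁ G * x ^ edgesIn G F₂ = ∏ e ∈ (⊤ : SimpleGraph V).edgeFinset,
      if e ∈ G.edgeSet then (if e ∈ F₂ then x else 1) else (if e ∈ F₁ then 0 else 1) := by
  rw [Finset.prod_ite, mul_comm]
  congr 1
  · rw [Finset.prod_ite, Finset.prod_const, Finset.prod_const_one, mul_one, edgesIn]
    congr 2
    ext e
    simp only [Finset.mem_filter]
    exact ⟨fun h => ⟨⟨h₂ h.1, h.2⟩, h.1⟩, fun h => ⟨h.2, h.1.2⟩⟩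
  · rw [containsInd]
    split_ifs with h
    · refine (Finset.prod_eq_one fun e he => ?_).symm
      rw [if_neg fun h' => (Finset.mem_filter.1 he).2 (h e h')]
    · push Not at h
      obtain ⟨e, he, heG⟩ := h
      symm
      refine Finset.prod_eq_zero (i := e) ?_ (if_pos he)
      exact Finset.mem_filter.2 ⟨h₁ he, heG⟩

theorem graphExp_containsInd_mul_pow (p : ℝ) {F₁ F₂ : Finset (Sym2 V)}
    (h₁ : F₁ ⊆ (⊤ : SimpleGraph V).edgeFinset) (h₂ : F₂ ⊆ (⊤ : SimpleGraph V).edgeFinset)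
    (hd : Disjoint F₁ F₂) (x : ℝ) :
    graphExp p (fun G => containsInd F₁ G * x ^ edgesIn G F₂) =
      p ^ F₁.card * (1 - p + p * x) ^ F₂.card := by
  simp_rw [containsInd_mul_pow_eq_prod F₁ h₁ h₂ x]
  rw [graphExp_prod]
  have h : ∀ e ∈ (⊤ : SimpleGraph V).edgeFinset,
      p * (if e ∈ F₂ then x else 1) + (1 - p) * (if e ∈ F₁ then 0 else 1) =
      (if e ∈ F₁ then p else 1) * (if e ∈ F₂ then 1 - p + p * x else 1) := by
    intro e _
    have hde : e ∈ F₁ → e ∉ F₂ := fun h => Finset.disjoint_left.1 hd h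
    split_ifs <;> first | tauto | ring
  rw [Finset.prod_congr rfl h, Finset.prod_mul_distrib, Finset.prod_ite_mem, Finset.prod_ite_mem,
    Finset.inter_eq_right.2 h₁, Finset.inter_eq_right.2 h₂, Finset.prod_const, Finset.prod_const]

theorem graphExp_pow (p : ℝ) {F : Finset (Sym2 V)} (h : F ⊆ (⊤ : SimpleGraph V).edgeFinset)
    (x : ℝ) : graphExp p (fun G => x ^ edgesIn G F) = (1 - p + p * x) ^ F.card := by
  simpa [containsInd] using graphExp_containsInd_mul_pow p (Finset.empty_subset _) h
    (Finset.disjoint_empty_left F) x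

theorem graphExp_one (p : ℝ) : graphExp p (fun _ : SimpleGraph V => 1) = 1 := by
  simpa [edgesIn] using graphExp_pow (V := V) p (Finset.empty_subset _) 1

theorem graphExp_mono {p : ℝ} (h0 : 0 ≤ p) (h1 : p ≤ 1) {f g : SimpleGraph V → ℝ}
    (h : ∀ G, f G ≤ g G) : graphExp p f ≤ graphExp p g :=
  Finset.sum_le_sum fun G _ => mul_le_mul_of_nonneg_left (h G)
    (mul_nonneg (pow_nonneg h0 _) (pow_nonneg (by linarith) _))

theorem graphExp_const_mul (p c : ℝ) (f : SimpleGraph V → ℝ) :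
    graphExp p (fun G => c * f G) = c * graphExp p f := by
  simp only [graphExp, Finset.mul_sum]
  exact Finset.sum_congr rfl fun G _ => by ring

theorem graphExp_add (p : ℝ) (f g : SimpleGraph V → ℝ) :
    graphExp p (fun G => f G + g G) = graphExp p f + graphExp p g := by
  simp only [graphExp, mul_add, Finset.sum_add_distrib]

theorem graphExp_sum (p : ℝ) {ι : Type*} (s : Finset ι) (f : ι → SimpleGraph V → ℝ) :
    graphExp p (fun G => ∑ i ∈ s, f i G) = ∑ i ∈ s, graphExp p (f i) := by
  simp only [graphExp, Finset.mul_sum]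
  exact Finset.sum_comm

/-- The probability of a property of the binomial random graph. -/
noncomputable def graphProb (p : ℝ) (P : SimpleGraph V → Prop) : ℝ :=
  graphExp p fun G => if P G then 1 else 0

theorem gnpProb_eq_graphProb (n : ℕ) (p : ℝ) (A : Set (SimpleGraph (Fin n))) :
    gnpProb n p A = graphProb p (· ∈ A) := by
  simp only [gnpProb, graphProb, graphExp, graphWeight, Finset.sum_filter, mul_ite, mul_one,
    mul_zero, Fintype.card_fin]
  congr!

theorem graphProb_le_of_imp {p : ℝ} (h0 : 0 ≤ p) (h1 : p ≤ 1) {P : SimpleGraph V → Prop}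
    {f : SimpleGraph V → ℝ} (hf : ∀ G, 0 ≤ f G) (h : ∀ G, P G → 1 ≤ f G) :
    graphProb p P ≤ graphExp p f := by
  refine graphExp_mono h0 h1 fun G => ?_
  split_ifs with hG
  · exact h G hG
  · exact hf G

theorem graphProb_le_one {p : ℝ} (h0 : 0 ≤ p) (h1 : p ≤ 1) (P : SimpleGraph V → Prop) :
    graphProb p P ≤ 1 :=
  (graphProb_le_of_imp h0 h1 (fun _ => zero_le_one) fun _ _ => le_rfl).trans (graphExp_one p).le

/-- The union bound. -/
theorem graphProb_exists_le {p : ℝ} (h0 : 0 ≤ p) (h1 : p ≤ 1) {ι : Type*} (s : Finset ι)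
    {P : SimpleGraph V → Prop} {f : ι → SimpleGraph V → ℝ} (hf : ∀ i G, 0 ≤ f i G)
    (h : ∀ G, P G → ∃ i ∈ s, 1 ≤ f i G) : graphProb p P ≤ ∑ i ∈ s, graphExp p (f i) := by
  rw [← graphExp_sum]
  refine graphProb_le_of_imp h0 h1 (fun G => Finset.sum_nonneg fun i _ => hf i G) fun G hG => ?_
  obtain ⟨i, hi, hi1⟩ := h G hG
  exact hi1.trans (Finset.single_le_sum (f := fun i => f i G) (fun i _ => hf i G) hi)

end Expectation

section PairSets

variable {V : Type*}

theorem edgesIn_le_of_subset_union (G : SimpleGraph V) {F F₁ F₂ : Finset (Sym2 V)}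
    (h : F ⊆ F₁ ∪ F₂) : edgesIn G F ≤ edgesIn G F₁ + edgesIn G F₂ := by
  rw [edgesIn, edgesIn, edgesIn]
  refine (Finset.card_le_card (Finset.filter_subset_filter _ h)).trans ?_
  rw [Finset.filter_union]
  exact Finset.card_union_le _ _

theorem zero_pow_edgesIn_mul (F₁ F₂ : Finset (Sym2 V)) (G : SimpleGraph V) :
    (0 : ℝ) ^ edgesIn G F₁ * 0 ^ edgesIn G F₂ = 0 ^ edgesIn G (F₁ ∪ F₂) := by
  rw [← pow_add]
  have : edgesIn G F₁ + edgesIn G F₂ = 0 ↔ edgesIn G (F₁ ∪ F₂) = 0 := by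
    simp only [edgesIn, Nat.add_eq_zero_iff, Finset.card_eq_zero, Finset.filter_union,
      Finset.union_eq_empty]
  simp only [zero_pow_eq, this]

/-- The pairs with one vertex in `A` and one in `B`. -/
noncomputable def pairsBetween (A B : Finset V) : Finset (Sym2 V) :=
  (A ×ˢ B).image fun q => s(q.1, q.2)

theorem card_pairsBetween {A B : Finset V} (h : Disjoint A B) :
    (pairsBetween A B).card = A.card * B.card := by
  rw [pairsBetween, Finset.card_image_of_injOn, Finset.card_product]
  rintro ⟨a, b⟩ hq ⟨a', b'⟩ hq' heq
  simp only [Finset.coe_product, Set.mem_prod, Finset.mem_coe] at hq hq'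
  rcases Sym2.eq_iff.1 heq with ⟨h1, h2⟩ | ⟨h1, h2⟩
  · simp only at h1 h2
    rw [h1, h2]
  · simp only at h1
    exact absurd hq'.2 (Finset.disjoint_left.1 h (h1 ▸ hq.1))

/-- The pairs joining `u` to the elements of `T`. -/
noncomputable def rays (u : V) (T : Finset V) : Finset (Sym2 V) :=
  T.image fun w => s(u, w)

theorem card_rays (u : V) (T : Finset V) : (rays u T).card = T.card :=
  Finset.card_image_of_injective _ fun _ _ h => Sym2.congr_right.1 h

theorem mk_mem_rays {u w : V} {T : Finset V} : s(u, w) ∈ rays u T ↔ w ∈ T := by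
  simp only [rays, Finset.mem_image, Sym2.congr_right, exists_eq_right]

end PairSets

section Stars

variable {V : Type*} [Fintype V]

/-- The pairs containing `v`. -/
noncomputable def starPairs (v : V) : Finset (Sym2 V) :=
  (⊤ : SimpleGraph V).edgeFinset.filter fun e => v ∈ e

theorem starPairs_subset (v : V) : starPairs v ⊆ (⊤ : SimpleGraph V).edgeFinset :=
  Finset.filter_subset _ _

theorem mem_starPairs {v : V} {e : Sym2 V} : e ∈ starPairs v ↔ ¬ e.IsDiag ∧ v ∈ e := by
  simp [starPairs]

theorem starPairs_eq_image (v : V) :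
    starPairs v = (Finset.univ.erase v).image fun w => s(v, w) := by
  ext e
  simp only [mem_starPairs, Finset.mem_image, Finset.mem_erase, Finset.mem_univ, and_true]
  constructor
  · rintro ⟨h, w, rfl⟩
    exact ⟨w, by simpa [eq_comm] using h, rfl⟩
  · rintro ⟨w, hw, rfl⟩
    exact ⟨by simpa [eq_comm] using hw, by simp⟩

theorem card_starPairs (v : V) : (starPairs v).card = Fintype.card V - 1 := by
  rw [starPairs_eq_image, Finset.card_image_of_injective _ fun a b h => Sym2.congr_right.1 h,
    Finset.card_erase_of_mem (Finset.mem_univ _), Finset.card_univ]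

theorem starPairs_inter_subset {u v : V} (huv : u ≠ v) :
    starPairs u ∩ starPairs v ⊆ {s(u, v)} := by
  intro e he
  rw [Finset.mem_inter, mem_starPairs, mem_starPairs] at he
  rw [Finset.mem_singleton]
  exact (Sym2.mem_and_mem_iff huv).1 ⟨he.1.2, he.2.2⟩

theorem edgesIn_starPairs (G : SimpleGraph V) (v : V) : edgesIn G (starPairs v) = G.degree v := by
  rw [← SimpleGraph.card_neighborFinset_eq_degree, edgesIn]
  have : (starPairs v).filter (· ∈ G.edgeSet) = (G.neighborFinset v).image fun w => s(v, w) := by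
    ext e
    simp only [Finset.mem_filter, mem_starPairs, Finset.mem_image, SimpleGraph.mem_neighborFinset]
    constructor
    · rintro ⟨⟨h, w, rfl⟩, h2⟩
      exact ⟨w, h2, rfl⟩
    · rintro ⟨w, hw, rfl⟩
      exact ⟨⟨by simpa using hw.ne, by simp⟩, hw⟩
  rw [this, Finset.card_image_of_injective _ fun a b h => Sym2.congr_right.1 h]

theorem card_starPairs_union_sdiff {u v : V} (huv : u ≠ v) {F : Finset (Sym2 V)}
    (hF : F.card ≤ 2) :
    2 * Fintype.card V - 5 ≤ ((starPairs u ∪ starPairs v) \ F).card := by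
  have h1 := Finset.card_union_add_card_inter (starPairs u) (starPairs v)
  have h2 := Finset.card_le_card (starPairs_inter_subset huv)
  have h3 := Finset.le_card_sdiff F (starPairs u ∪ starPairs v)
  rw [card_starPairs, card_starPairs] at h1
  rw [Finset.card_singleton] at h2
  omega

end Stars

section FirstMoment

variable {V : Type*} [Fintype V] {p : ℝ}

theorem graphProb_exists_degree_le (h0 : 0 ≤ p) (h1 : p ≤ 1) (k : ℕ) {x : ℝ} (hx : 0 < x)
    (hx1 : x ≤ 1) : graphProb p (fun G : SimpleGraph V => ∃ v, G.degree v ≤ k) ≤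
      Fintype.card V * ((x ^ k)⁻¹ * (1 - p + p * x) ^ (Fintype.card V - 1)) := by
  refine (graphProb_exists_le h0 h1 (Finset.univ : Finset V)
    (f := fun v G => (x ^ k)⁻¹ * x ^ edgesIn G (starPairs v)) ?_ ?_).trans ?_
  · intro v G
    positivity
  · rintro G ⟨v, hv⟩
    refine ⟨v, Finset.mem_univ _, ?_⟩
    rw [edgesIn_starPairs, ← div_eq_inv_mul, one_le_div (by positivity)]
    exact pow_le_pow_of_le_one hx.le hx1 hv
  · refine le_of_eq ?_
    simp_rw [graphExp_const_mul, graphExp_pow p (starPairs_subset _), card_starPairs]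
    simp

theorem graphExp_small_pair_le (h0 : 0 ≤ p) (h1 : p ≤ 1) {x : ℝ} (hx : 0 < x) (hx1 : x ≤ 1)
    {u v : V} (huv : u ≠ v) {F : Finset (Sym2 V)} (hF : F ⊆ (⊤ : SimpleGraph V).edgeFinset)
    (hF2 : F.card ≤ 2) (D : ℕ) :
    graphExp p (fun G => (x ^ (2 * D))⁻¹ * (containsInd F G *
      x ^ edgesIn G ((starPairs u ∪ starPairs v) \ F))) ≤
      (x ^ (2 * D))⁻¹ * (p ^ F.card * (1 - p + p * x) ^ (2 * Fintype.card V - 5)) := by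
  rw [graphExp_const_mul, graphExp_containsInd_mul_pow p hF (Finset.sdiff_subset.trans
    (Finset.union_subset (starPairs_subset _) (starPairs_subset _))) Finset.disjoint_sdiff]
  have h2 : 0 ≤ 1 - p + p * x := by nlinarith
  have h3 : 1 - p + p * x ≤ 1 := by nlinarith
  gcongr ?_ * (?_ * ?_)
  exact pow_le_pow_of_le_one h2 h3 (card_starPairs_union_sdiff huv hF2)

theorem one_le_small_pair {x : ℝ} (hx : 0 < x) (hx1 : x ≤ 1) {G : SimpleGraph V} {u v : V}
    {F : Finset (Sym2 V)} {D : ℕ} (hF : ∀ e ∈ F, e ∈ G.edgeSet) (hu : G.degree u < D)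
    (hv : G.degree v < D) : 1 ≤ (x ^ (2 * D))⁻¹ * (containsInd F G *
      x ^ edgesIn G ((starPairs u ∪ starPairs v) \ F)) := by
  rw [containsInd, if_pos hF, one_mul, ← div_eq_inv_mul, one_le_div (by positivity)]
  refine pow_le_pow_of_le_one hx.le hx1 ?_
  have := edgesIn_le_of_subset_union G (F := (starPairs u ∪ starPairs v) \ F)
    Finset.sdiff_subset
  rw [edgesIn_starPairs, edgesIn_starPairs] at this
  omega

theorem containsInd_nonneg (F : Finset (Sym2 V)) (G : SimpleGraph V) : 0 ≤ containsInd F G := by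
  rw [containsInd]
  split_ifs <;> norm_num

theorem graphProb_exists_small_adj (h0 : 0 ≤ p) (h1 : p ≤ 1) {x : ℝ} (hx : 0 < x)
    (hx1 : x ≤ 1) (D : ℕ) :
    graphProb p (fun G : SimpleGraph V => ∃ u v, G.degree u < D ∧ G.degree v < D ∧ G.Adj u v) ≤
      Fintype.card V ^ 2 *
        ((x ^ (2 * D))⁻¹ * (p * (1 - p + p * x) ^ (2 * Fintype.card V - 5))) := by
  have h2 : 0 ≤ 1 - p + p * x := by nlinarith
  refine (graphProb_exists_le h0 h1
    ((Finset.univ : Finset (V × V)).filter fun q => q.1 ≠ q.2)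
    (f := fun q G => (x ^ (2 * D))⁻¹ * (containsInd {s(q.1, q.2)} G *
      x ^ edgesIn G ((starPairs q.1 ∪ starPairs q.2) \ {s(q.1, q.2)}))) ?_ ?_).trans ?_
  · intro q G
    have := containsInd_nonneg {s(q.1, q.2)} G
    positivity
  · rintro G ⟨u, v, hu, hv, huv⟩
    refine ⟨(u, v), by simpa using huv.ne, one_le_small_pair hx hx1 ?_ hu hv⟩
    simpa using huv
  · refine (Finset.sum_le_card_nsmul _ _
      ((x ^ (2 * D))⁻¹ * (p * (1 - p + p * x) ^ (2 * Fintype.card V - 5))) ?_).trans ?_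
    · intro q hq
      have hq' : q.1 ≠ q.2 := (Finset.mem_filter.1 hq).2
      simpa using graphExp_small_pair_le h0 h1 hx hx1 hq' (F := {s(q.1, q.2)})
        (by simpa using hq') (by simp) D
    · rw [nsmul_eq_mul]
      refine mul_le_mul_of_nonneg_right ?_ (by positivity)
      have := (Finset.card_filter_le (Finset.univ : Finset (V × V)) fun q => q.1 ≠ q.2)
      rw [Finset.card_univ, Fintype.card_prod, ← sq] at this
      exact_mod_cast this

theorem graphProb_exists_small_common (h0 : 0 ≤ p) (h1 : p ≤ 1) {x : ℝ} (hx : 0 < x)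
    (hx1 : x ≤ 1) (D : ℕ) :
    graphProb p (fun G : SimpleGraph V => ∃ u v w, u ≠ v ∧ G.degree u < D ∧ G.degree v < D ∧
      G.Adj u w ∧ G.Adj w v) ≤
      Fintype.card V ^ 3 *
        ((x ^ (2 * D))⁻¹ * (p ^ 2 * (1 - p + p * x) ^ (2 * Fintype.card V - 5))) := by
  have h2 : 0 ≤ 1 - p + p * x := by nlinarith
  refine (graphProb_exists_le h0 h1
    ((Finset.univ : Finset (V × V × V)).filter fun q =>
      q.1 ≠ q.2.1 ∧ q.1 ≠ q.2.2 ∧ q.2.2 ≠ q.2.1)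
    (f := fun q G => (x ^ (2 * D))⁻¹ * (containsInd {s(q.1, q.2.2), s(q.2.2, q.2.1)} G *
      x ^ edgesIn G ((starPairs q.1 ∪ starPairs q.2.1) \ {s(q.1, q.2.2), s(q.2.2, q.2.1)})))
    ?_ ?_).trans ?_
  · intro q G
    have := containsInd_nonneg {s(q.1, q.2.2), s(q.2.2, q.2.1)} G
    positivity
  · rintro G ⟨u, v, w, huv, hu, hv, huw, hwv⟩
    refine ⟨(u, v, w), by simpa using ⟨huv, huw.ne, hwv.ne⟩, one_le_small_pair hx hx1 ?_ hu hv⟩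
    simpa using ⟨huw, hwv⟩
  · refine (Finset.sum_le_card_nsmul _ _
      ((x ^ (2 * D))⁻¹ * (p ^ 2 * (1 - p + p * x) ^ (2 * Fintype.card V - 5))) ?_).trans ?_
    · rintro ⟨u, v, w⟩ hq
      obtain ⟨huv, huw, hwv⟩ : u ≠ v ∧ u ≠ w ∧ w ≠ v := (Finset.mem_filter.1 hq).2
      have hc : ({s(u, w), s(w, v)} : Finset (Sym2 V)).card = 2 := by
        rw [Finset.card_pair]
        intro h
        rw [Sym2.eq_swap] at h
        exact huv (Sym2.congr_right.1 h)
      have := graphExp_small_pair_le h0 h1 hx hx1 huv (F := {s(u, w), s(w, v)})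
        (by
          intro e he
          rcases Finset.mem_insert.1 he with rfl | he
          · simpa using huw
          · rw [Finset.mem_singleton] at he
            subst he
            simpa using hwv) hc.le D
      rwa [hc] at this
    · rw [nsmul_eq_mul]
      refine mul_le_mul_of_nonneg_right ?_ (by positivity)
      have := (Finset.card_filter_le (Finset.univ : Finset (V × V × V)) fun q =>
        q.1 ≠ q.2.1 ∧ q.1 ≠ q.2.2 ∧ q.2.2 ≠ q.2.1)
      rw [Finset.card_univ, Fintype.card_prod, Fintype.card_prod] at this
      rw [pow_succ', sq]
      exact_mod_cast this

theorem card_pairsIn_le (U : Finset V) : (pairsIn U).card ≤ U.card ^ 2 := by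
  rw [sq, ← Finset.card_product]
  refine (Finset.card_le_card (t := (U ×ˢ U).image fun q => s(q.1, q.2)) ?_).trans
    Finset.card_image_le
  intro e he
  induction e using Sym2.ind with
  | _ x y =>
    have h := (Finset.mem_filter.1 he).2
    exact Finset.mem_image.2 ⟨(x, y), Finset.mem_product.2 ⟨h x (by simp), h y (by simp)⟩, rfl⟩

theorem pairsIn_subset (U : Finset V) : pairsIn U ⊆ (⊤ : SimpleGraph V).edgeFinset :=
  Finset.filter_subset _ _

theorem graphProb_exists_dense (h0 : 0 ≤ p) (h1 : p ≤ 1) (C D M : ℕ) {Y θ : ℝ} (hY : 0 ≤ Y)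
    (hM : p * Real.exp Y * M ≤ Y * D / (2 * (C + 1)) - θ) :
    graphProb p (fun G : SimpleGraph V => ∃ U : Finset V, U.Nonempty ∧ U.card ≤ M ∧
      D * U.card ≤ 2 * (C + 1) * edgesIn G (pairsIn U)) ≤
      (1 + Real.exp (-θ)) ^ Fintype.card V - 1 := by
  have hsum : ∑ U ∈ (Finset.univ : Finset V).powerset.erase ∅, Real.exp (-θ) ^ U.card =
      (1 + Real.exp (-θ)) ^ Fintype.card V - 1 := by
    have h := Finset.sum_pow_mul_eq_add_pow (Real.exp (-θ)) 1 (Finset.univ : Finset V)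
    rw [← Finset.add_sum_erase _ _ (Finset.empty_mem_powerset _)] at h
    simp only [one_pow, mul_one, Finset.card_empty, pow_zero, Finset.card_univ] at h
    rw [add_comm 1 (Real.exp (-θ)), ← h]
    ring
  rw [← hsum]
  refine (graphProb_exists_le h0 h1
    (((Finset.univ : Finset V).powerset.erase ∅).filter fun U => U.card ≤ M)
    (f := fun U G => Real.exp (-(Y * D / (2 * (C + 1)) * U.card)) *
      Real.exp Y ^ edgesIn G (pairsIn U)) ?_ ?_).trans ?_
  · intro U G
    positivity
  · rintro G ⟨U, hU, hUM, hUD⟩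
    refine ⟨U, by simp [hU.ne_empty, hUM], ?_⟩
    rw [← Real.exp_nat_mul, ← Real.exp_add, Real.one_le_exp_iff]
    have h3 : (D : ℝ) * U.card ≤ 2 * (C + 1) * edgesIn G (pairsIn U) := by exact_mod_cast hUD
    have h4 : Y * D / (2 * (C + 1)) * U.card = Y * (D * U.card) / (2 * (C + 1)) := by ring
    rw [h4, neg_add_eq_sub, sub_nonneg, div_le_iff₀ (by positivity)]
    nlinarith
  · refine le_trans (Finset.sum_le_sum fun U hU => ?_)
      (Finset.sum_le_sum_of_subset_of_nonneg (Finset.filter_subset _ _) fun U _ _ => by positivity)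
    have hUM : (U.card : ℝ) ≤ M := by exact_mod_cast (Finset.mem_filter.1 hU).2
    rw [graphExp_const_mul, graphExp_pow p (pairsIn_subset U), ← Real.exp_nat_mul]
    have h5 : 1 - p + p * Real.exp Y ≤ Real.exp (p * Real.exp Y) := by
      have := Real.add_one_le_exp (p * Real.exp Y)
      linarith
    have h6 : (0 : ℝ) ≤ 1 - p + p * Real.exp Y := by
      have := mul_nonneg h0 (Real.exp_pos Y).le
      linarith
    calc _ ≤ Real.exp (-(Y * D / (2 * (C + 1)) * U.card)) *
          Real.exp (p * Real.exp Y) ^ (pairsIn U).card := by gcongr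
      _ ≤ Real.exp (-(Y * D / (2 * (C + 1)) * U.card)) *
          Real.exp (p * Real.exp Y) ^ (U.card ^ 2) := by
          gcongr
          · exact Real.one_le_exp (by positivity)
          · exact card_pairsIn_le U
      _ = Real.exp (-(Y * D / (2 * (C + 1)) * U.card) + (U.card ^ 2 : ℕ) * (p * Real.exp Y)) := by
          rw [← Real.exp_nat_mul, ← Real.exp_add]
      _ ≤ _ := by
          rw [Real.exp_le_exp]
          have h7 : p * Real.exp Y * U.card ≤ Y * D / (2 * (C + 1)) - θ :=
            (mul_le_mul_of_nonneg_left hUM (by positivity)).trans hM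
          have h8 : (0 : ℝ) ≤ U.card := by positivity
          push_cast
          nlinarith

theorem pairsBetween_subset {A B : Finset V} (h : Disjoint A B) :
    pairsBetween A B ⊆ (⊤ : SimpleGraph V).edgeFinset := by
  intro e he
  obtain ⟨⟨a, b⟩, hq, rfl⟩ := Finset.mem_image.1 he
  rw [Finset.mem_product] at hq
  simpa using fun hab : a = b => Finset.disjoint_left.1 h hq.1 (hab ▸ hq.2)

theorem graphProb_exists_unjoined (h0 : 0 ≤ p) (h1 : p ≤ 1) (s : ℕ) :
    graphProb p (fun G : SimpleGraph V => ∃ A B : Finset V, Disjoint A B ∧ s ≤ A.card ∧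
      s ≤ B.card ∧ ∀ a ∈ A, ∀ b ∈ B, ¬ G.Adj a b) ≤ 4 ^ Fintype.card V * (1 - p) ^ s ^ 2 := by
  refine (graphProb_exists_le h0 h1 ((Finset.univ : Finset (Finset V × Finset V)).filter fun q =>
    Disjoint q.1 q.2 ∧ s ≤ q.1.card ∧ s ≤ q.2.card)
    (f := fun q G => 0 ^ edgesIn G (pairsBetween q.1 q.2)) ?_ ?_).trans ?_
  · intro q G
    positivity
  · rintro G ⟨A, B, hAB, hA, hB, h⟩
    refine ⟨(A, B), by simp [hAB, hA, hB], ?_⟩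
    have : edgesIn G (pairsBetween A B) = 0 := by
      rw [edgesIn, Finset.card_eq_zero, Finset.filter_eq_empty_iff]
      intro e he
      obtain ⟨⟨a, b⟩, hq, rfl⟩ := Finset.mem_image.1 he
      rw [Finset.mem_product] at hq
      exact h a hq.1 b hq.2
    rw [this, pow_zero]
  · refine (Finset.sum_le_card_nsmul _ _ ((1 - p) ^ s ^ 2) ?_).trans ?_
    · intro q hq
      obtain ⟨hd, hA, hB⟩ := (Finset.mem_filter.1 hq).2
      rw [graphExp_pow p (pairsBetween_subset hd), card_pairsBetween hd, mul_zero, add_zero]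
      refine pow_le_pow_of_le_one (by linarith) (by linarith) ?_
      rw [sq]
      exact Nat.mul_le_mul hA hB
    · rw [nsmul_eq_mul]
      refine mul_le_mul_of_nonneg_right ?_ (pow_nonneg (by linarith) _)
      have := (Finset.card_filter_le (Finset.univ : Finset (Finset V × Finset V)) fun q =>
        Disjoint q.1 q.2 ∧ s ≤ q.1.card ∧ s ≤ q.2.card)
      rw [Finset.card_univ, Fintype.card_prod, Fintype.card_finset, ← mul_pow] at this
      exact_mod_cast this

end FirstMoment

section SecondMoment

variable {V : Type*} [Fintype V] {p : ℝ}

/-- Chebyshev's inequality for a sum of indicators with small pairwise correlations. -/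
theorem graphProb_le_of_correlation {ι : Type*} (h0 : 0 ≤ p) (h1 : p < 1) (I : Finset ι)
    {Y : ι → SimpleGraph V → ℝ} {q : ℝ} {P : SimpleGraph V → Prop} (hq : 0 < I.card * q)
    (hY : ∀ i ∈ I, ∀ G, Y i G * Y i G = Y i G) (hE : ∀ i ∈ I, graphExp p (Y i) = q)
    (hcorr : ∀ i ∈ I, ∀ j ∈ I, i ≠ j → (1 - p) * graphExp p (fun G => Y i G * Y j G) ≤ q ^ 2)
    (hP : ∀ G, P G → ∀ i ∈ I, Y i G = 0) :
    graphProb p P ≤ 1 / (I.card * q) + p / (1 - p) := by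
  set μ : ℝ := I.card * q with hμ
  have hp : 0 < 1 - p := by linarith
  have hEX : graphExp p (fun G => ∑ i ∈ I, Y i G) = μ := by
    rw [graphExp_sum, Finset.sum_congr rfl hE, Finset.sum_const, nsmul_eq_mul]
  have hEX2 : graphExp p (fun G => (∑ i ∈ I, Y i G) * ∑ j ∈ I, Y j G) ≤
      μ + μ ^ 2 / (1 - p) := by
    simp_rw [Finset.sum_mul_sum]
    rw [graphExp_sum]
    simp_rw [graphExp_sum]
    calc _ ≤ ∑ i ∈ I, ∑ j ∈ I, ((if i = j then q else 0) + q ^ 2 / (1 - p)) := by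
          refine Finset.sum_le_sum fun i hi => Finset.sum_le_sum fun j hj => ?_
          split_ifs with hij
          · subst hij
            simp_rw [hY i hi]
            have : 0 ≤ q ^ 2 / (1 - p) := by positivity
            linarith [hE i hi]
          · rw [zero_add, le_div_iff₀ hp, mul_comm]
            exact hcorr i hi j hj hij
      _ = _ := by
          simp only [Finset.sum_add_distrib, Finset.sum_ite_eq, Finset.sum_const, nsmul_eq_mul]
          rw [Finset.sum_ite_mem, Finset.inter_self, Finset.sum_const, nsmul_eq_mul, hμ]
          ring
  have h2 : graphProb p P ≤ graphExp p (fun G => (μ ^ 2)⁻¹ *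
      ((∑ i ∈ I, Y i G) * (∑ j ∈ I, Y j G) + (-(2 * μ) * (∑ i ∈ I, Y i G) + μ ^ 2 * 1))) := by
    refine graphProb_le_of_imp h0 h1.le (fun G => ?_) fun G hG => ?_
    · have := sq_nonneg ((∑ i ∈ I, Y i G) - μ)
      refine mul_nonneg (by positivity) ?_
      linarith
    · rw [Finset.sum_eq_zero (hP G hG)]
      field_simp
      linarith
  refine h2.trans ?_
  rw [graphExp_const_mul, graphExp_add, graphExp_add, graphExp_const_mul, graphExp_const_mul, hEX,
    graphExp_one, inv_mul_le_iff₀ (by positivity)]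
  have h3 : μ ^ 2 * (1 / μ + p / (1 - p)) = μ + μ ^ 2 / (1 - p) - μ ^ 2 := by
    field_simp
    ring
  rw [h3]
  linarith

theorem rays_subset {u : V} {T : Finset V} (hu : u ∉ T) : rays u T ⊆ starPairs u := by
  intro e he
  obtain ⟨w, hw, rfl⟩ := Finset.mem_image.1 he
  rw [mem_starPairs]
  exact ⟨by simpa using fun h : u = w => hu (h ▸ hw), by simp⟩

/-- The indicator of the event that the neighbourhood of `u` is `T`. -/
noncomputable def nbhdInd (u : V) (T : Finset V) (G : SimpleGraph V) : ℝ :=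
  containsInd (rays u T) G * 0 ^ edgesIn G (starPairs u \ rays u T)

theorem nbhdInd_mul_self (u : V) (T : Finset V) (G : SimpleGraph V) :
    nbhdInd u T G * nbhdInd u T G = nbhdInd u T G := by
  rw [nbhdInd, containsInd]
  rcases Nat.eq_zero_or_pos (edgesIn G (starPairs u \ rays u T)) with h | h
  · rw [h]
    split_ifs <;> simp
  · rw [zero_pow h.ne']
    simp

theorem graphExp_nbhdInd {u : V} {T : Finset V} (hu : u ∉ T) :
    graphExp p (nbhdInd u T) = p ^ T.card * (1 - p) ^ (Fintype.card V - 1 - T.card) := by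
  have h := graphExp_containsInd_mul_pow p ((rays_subset hu).trans (starPairs_subset u))
    (Finset.sdiff_subset.trans (starPairs_subset u)) Finset.disjoint_sdiff 0
  rw [mul_zero, add_zero, Finset.card_sdiff_of_subset (rays_subset hu), card_starPairs,
    card_rays] at h
  exact h

theorem nbhdInd_eq_zero_of_lt_degree {G : SimpleGraph V} {u : V} {T : Finset V}
    (h : T.card < G.degree u) : nbhdInd u T G = 0 := by
  have h1 := edgesIn_le_of_subset_union G (F := starPairs u) (F₁ := rays u T)
    (F₂ := starPairs u \ rays u T) (by simp)
  have h2 : edgesIn G (rays u T) ≤ T.card :=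
    (Finset.card_le_card (Finset.filter_subset _ _)).trans_eq (card_rays u T)
  rw [edgesIn_starPairs] at h1
  rw [nbhdInd, zero_pow (by omega), mul_zero]

theorem nbhdInd_mul_eq_zero {G : SimpleGraph V} {u : V} {T T' : Finset V} (hu : u ∉ T)
    (hc : T'.card ≤ T.card) (hT : T ≠ T') : nbhdInd u T G * nbhdInd u T' G = 0 := by
  obtain ⟨w, hw, hw'⟩ : ∃ w ∈ T, w ∉ T' := by
    by_contra! h
    exact hT (Finset.eq_of_subset_of_card_le h hc)
  by_cases hG : s(u, w) ∈ G.edgeSet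
  · have : edgesIn G (starPairs u \ rays u T') ≠ 0 := by
      rw [edgesIn, Finset.card_ne_zero]
      exact ⟨s(u, w), Finset.mem_filter.2 ⟨Finset.mem_sdiff.2
        ⟨rays_subset hu (mk_mem_rays.2 hw), fun h => hw' (mk_mem_rays.1 h)⟩, hG⟩⟩
    rw [nbhdInd, nbhdInd, zero_pow this, mul_zero, mul_zero]
  · rw [nbhdInd, containsInd, if_neg fun h => hG (h _ (mk_mem_rays.2 hw)), zero_mul, zero_mul]

theorem containsInd_mul_containsInd (F₁ F₂ : Finset (Sym2 V)) (G : SimpleGraph V) :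
    containsInd F₁ G * containsInd F₂ G = containsInd (F₁ ∪ F₂) G := by
  simp only [containsInd, Finset.mem_union, or_imp, forall_and]
  split_ifs <;> simp_all

theorem graphExp_nbhdInd_mul_le (h0 : 0 ≤ p) (h1 : p ≤ 1) {u v : V} (huv : u ≠ v)
    {T T' : Finset V} (hu : u ∉ T) (hv : v ∉ T) (hu' : u ∉ T') (hv' : v ∉ T') :
    (1 - p) * graphExp p (fun G => nbhdInd u T G * nbhdInd v T' G) ≤
      graphExp p (nbhdInd u T) * graphExp p (nbhdInd v T') := by
  have hp : 0 ≤ 1 - p := by linarith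
  have hA := rays_subset hu
  have hB := rays_subset hv'
  have huvA : s(u, v) ∉ rays u T := fun h => hv (mk_mem_rays.1 h)
  have huvB : s(u, v) ∉ rays v T' := fun h => hu' (mk_mem_rays.1 (Sym2.eq_swap ▸ h))
  have hstar : ∀ e ∈ starPairs u, e ∈ starPairs v → e = s(u, v) := fun e he he' =>
    Finset.mem_singleton.1 (starPairs_inter_subset huv (Finset.mem_inter.2 ⟨he, he'⟩))
  have hdisj : Disjoint (rays u T) (rays v T') := Finset.disjoint_left.2 fun e he he' =>
    huvA (hstar e (hA he) (hB he') ▸ he)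
  have hd : Disjoint (rays u T ∪ rays v T')
      ((starPairs u \ rays u T) ∪ (starPairs v \ rays v T')) := by
    rw [Finset.disjoint_left]
    intro e he he'
    rw [Finset.mem_union] at he
    rw [Finset.mem_union, Finset.mem_sdiff, Finset.mem_sdiff] at he'
    rcases he with he | he <;> rcases he' with he' | he'
    · exact he'.2 he
    · exact huvA (hstar e (hA he) he'.1 ▸ he)
    · exact huvB (hstar e he'.1 (hB he) ▸ he)
    · exact he'.2 he
  have hcard : (starPairs u \ rays u T).card + (starPairs v \ rays v T').card ≤
      ((starPairs u \ rays u T) ∪ (starPairs v \ rays v T')).card + 1 := by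
    rw [← Finset.card_union_add_card_inter]
    refine Nat.add_le_add_left ?_ _
    refine (Finset.card_le_card ((Finset.inter_subset_inter Finset.sdiff_subset
      Finset.sdiff_subset).trans (starPairs_inter_subset huv))).trans_eq (Finset.card_singleton _)
  have h := graphExp_containsInd_mul_pow p
    (Finset.union_subset (hA.trans (starPairs_subset u)) (hB.trans (starPairs_subset v)))
    (Finset.union_subset (Finset.sdiff_subset.trans (starPairs_subset u))
      (Finset.sdiff_subset.trans (starPairs_subset v))) hd 0
  have h2 : ∀ G : SimpleGraph V, nbhdInd u T G * nbhdInd v T' G =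
      containsInd (rays u T ∪ rays v T') G *
        0 ^ edgesIn G ((starPairs u \ rays u T) ∪ (starPairs v \ rays v T')) := by
    intro G
    rw [← containsInd_mul_containsInd, ← zero_pow_edgesIn_mul, nbhdInd, nbhdInd]
    ring
  simp_rw [h2]
  rw [h, mul_zero, add_zero, Finset.card_union_of_disjoint hdisj, graphExp_nbhdInd hu,
    graphExp_nbhdInd hv', card_rays, card_rays, ← card_starPairs u]
  rw [Finset.card_sdiff_of_subset hA, Finset.card_sdiff_of_subset hB, card_rays, card_rays,
    card_starPairs v, ← card_starPairs u] at hcard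
  calc _ = p ^ (T.card + T'.card) * (1 - p) ^
        (((starPairs u \ rays u T) ∪ (starPairs v \ rays v T')).card + 1) := by ring
    _ ≤ p ^ (T.card + T'.card) * (1 - p) ^
        ((starPairs u).card - T.card + ((starPairs u).card - T'.card)) := by
        refine mul_le_mul_of_nonneg_left ?_ (by positivity)
        exact pow_le_pow_of_le_one hp (by linarith) hcard
    _ = _ := by ring

theorem graphProb_forall_lt_degree_le_of_index (h0 : 0 < p) (h1 : p < 1) {W : Finset V} {d : ℕ}
    {I : Finset (V × Finset V)} (hI : I.Nonempty)
    (hmem : ∀ i ∈ I, (∀ w ∈ W, w ∉ i.2) ∧ i.1 ∈ W ∧ i.2.card = d) :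
    graphProb p (fun G : SimpleGraph V => ∀ v, d < G.degree v) ≤
      1 / (I.card * (p ^ d * (1 - p) ^ (Fintype.card V - 1 - d))) + p / (1 - p) := by
  have hp : 0 < 1 - p := by linarith
  have hE : ∀ i ∈ I, graphExp p (nbhdInd i.1 i.2) =
      p ^ d * (1 - p) ^ (Fintype.card V - 1 - d) := by
    intro i hi
    obtain ⟨h2, h3, h4⟩ := hmem i hi
    rw [graphExp_nbhdInd (h2 _ h3), h4]
  refine graphProb_le_of_correlation h0.le h1 I (Y := fun i => nbhdInd i.1 i.2) ?_
    (fun i _ G => nbhdInd_mul_self _ _ G) hE ?_ ?_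
  · have : 0 < (I.card : ℝ) := by exact_mod_cast hI.card_pos
    positivity
  · intro i hi j hj hij
    obtain ⟨h2, h3, h4⟩ := hmem i hi
    obtain ⟨h2', h3', h4'⟩ := hmem j hj
    by_cases huv : i.1 = j.1
    · have hT : i.2 ≠ j.2 := fun h => hij (Prod.ext huv h)
      have hz : (fun G : SimpleGraph V => nbhdInd i.1 i.2 G * nbhdInd j.1 j.2 G) = fun _ => 0 := by
        funext G
        rw [← huv]
        exact nbhdInd_mul_eq_zero (h2 _ h3) (by omega) hT
      rw [hz]
      simp only [graphExp, mul_zero, Finset.sum_const_zero]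
      positivity
    · have := graphExp_nbhdInd_mul_le h0.le h1.le huv (h2 _ h3) (h2 _ h3') (h2' _ h3) (h2' _ h3')
      rwa [hE i hi, hE j hj, ← sq] at this
  · intro G hG i hi
    obtain ⟨_, _, h4⟩ := hmem i hi
    exact nbhdInd_eq_zero_of_lt_degree (h4 ▸ hG i.1)

theorem graphProb_forall_lt_degree_le (h0 : 0 < p) (h1 : p < 1) (W : Finset V) (d : ℕ)
    (hW : W.Nonempty) (hd : d ≤ Wᶜ.card) :
    graphProb p (fun G : SimpleGraph V => ∀ v, d < G.degree v) ≤
      1 / ((W.card * Wᶜ.card.choose d : ℕ) * (p ^ d * (1 - p) ^ (Fintype.card V - 1 - d))) +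
        p / (1 - p) := by
  obtain ⟨I, hI⟩ : ∃ I, I = W ×ˢ Wᶜ.powersetCard d := ⟨_, rfl⟩
  have hcard : I.card = W.card * Wᶜ.card.choose d := by
    rw [hI, Finset.card_product, Finset.card_powersetCard]
  rw [← hcard]
  refine graphProb_forall_lt_degree_le_of_index h0 h1 (W := W) ?_ fun i hi => ?_
  · rw [← Finset.card_pos, hcard]
    exact Nat.mul_pos hW.card_pos (Nat.choose_pos hd)
  · rw [hI, Finset.mem_product, Finset.mem_powersetCard] at hi
    exact ⟨fun w hw hw' => Finset.mem_compl.1 (hi.2.1 hw') hw, hi.1, hi.2.2⟩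

end SecondMoment

section Bounds

variable {V : Type*} [Fintype V] {p L ℓ lam : ℝ}

theorem graphProb_true : graphProb p (fun _ : SimpleGraph V => True) = 1 := by
  simpa [graphProb] using graphExp_one (V := V) p

theorem graphProb_or_le (h0 : 0 ≤ p) (h1 : p ≤ 1) (P Q : SimpleGraph V → Prop) :
    graphProb p (fun G => P G ∨ Q G) ≤ graphProb p P + graphProb p Q := by
  rw [graphProb, graphProb, graphProb, ← graphExp_add]
  refine graphExp_mono h0 h1 fun G => ?_
  by_cases hP : P G <;> by_cases hQ : Q G <;> simp [hP, hQ]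

theorem one_le_graphProb_bounds_add (h0 : 0 ≤ p) (h1 : p ≤ 1) (hV : 3 ≤ Fintype.card V)
    {k D C s : ℕ} (hk : 1 ≤ k) (hC : 6 * k + 5 ≤ C) (hs : 1 ≤ s) (hD : 3 * k + 4 ≤ D) :
    1 ≤ graphProb p (fun G : SimpleGraph V =>
        k ≤ genKappa 3 G ∧ genKappa 3 G ≤ genLambda 3 G ∧ genLambda 3 G ≤ k + 1) +
      (graphProb p (fun G : SimpleGraph V => ∃ v, G.degree v ≤ k) +
      (graphProb p (fun G : SimpleGraph V => ∃ u v, G.degree u < D ∧ G.degree v < D ∧ G.Adj u v) +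
      (graphProb p (fun G : SimpleGraph V => ∃ u v w, u ≠ v ∧ G.degree u < D ∧ G.degree v < D ∧
        G.Adj u w ∧ G.Adj w v) +
      (graphProb p (fun G : SimpleGraph V => ∃ U : Finset V, U.Nonempty ∧ U.card ≤ (C + 1) * s ∧
        D * U.card ≤ 2 * (C + 1) * edgesIn G (pairsIn U)) +
      (graphProb p (fun G : SimpleGraph V => ∃ A B : Finset V, Disjoint A B ∧ s ≤ A.card ∧
        s ≤ B.card ∧ ∀ a ∈ A, ∀ b ∈ B, ¬ G.Adj a b) +
      graphProb p (fun G : SimpleGraph V => ∀ v, k + 1 < G.degree v)))))) := by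
  rw [← graphProb_true (V := V) (p := p)]
  refine le_trans (graphProb_le_of_imp h0 h1 (fun G => by split_ifs <;> norm_num) fun G _ => ?_)
    ((graphProb_or_le h0 h1 _ _).trans <| add_le_add_right ((graphProb_or_le h0 h1 _ _).trans <|
    add_le_add_right ((graphProb_or_le h0 h1 _ _).trans <|
    add_le_add_right ((graphProb_or_le h0 h1 _ _).trans <|
    add_le_add_right ((graphProb_or_le h0 h1 _ _).trans <|
    add_le_add_right (graphProb_or_le h0 h1 _ _) _) _) _) _) _)
  rw [if_pos]
  by_contra h
  push Not at h
  obtain ⟨hgood, hdeg, hadj, hcom, hdense, hjoin, v, hv⟩ := h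
  have hps : IsPseudorandom G k D C s :=
    { le_degree := fun v => hdeg v
      not_adj := fun u v _ hu hv => hadj u v hu hv
      no_common := fun u v w huv hu hv h => hcom u v w huv hu hv h.1 h.2
      sparse := fun U hU hUc => hdense U hU hUc
      joined := fun A B hAB hA hB => hjoin A B hAB hA hB }
  exact absurd ((genLambda_le_degree hV G v).trans hv)
    (not_le.2 (hgood (hps.le_genKappa hV hk hC hs hD) (genKappa_le_genLambda hV G)))

theorem one_sub_pow_le_exp (h1 : p ≤ 1) (m : ℕ) : (1 - p) ^ m ≤ Real.exp (-(m * p)) := by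
  have h := Real.add_one_le_exp (-p)
  calc (1 - p) ^ m ≤ Real.exp (-p) ^ m := pow_le_pow_left₀ (by linarith) (by linarith) m
    _ = _ := by rw [← Real.exp_nat_mul]; ring_nf

theorem minDegree_bound {k N : ℕ} (hN : (N : ℝ) = Real.exp L) (hp : p * N = lam) (h1 : p ≤ 1)
    (hL : 1 ≤ L) (hlam : L ≤ lam) (hlam' : lam ≤ 2 * L)
    (hexp : Real.exp L * Real.exp (-lam) * L ^ (k + 1) = ℓ) :
    N * ((lam⁻¹ ^ k)⁻¹ * (1 - p + p * lam⁻¹) ^ (N - 1)) ≤ Real.exp 2 * 2 ^ k * (ℓ / L) := by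
  have hlam0 : 0 < lam := by linarith
  have hN0 : (0 : ℝ) < N := hN ▸ Real.exp_pos L
  have hN1 : 1 ≤ N := by exact_mod_cast hN0
  have hp0 : 0 < p := pos_of_mul_pos_left (hp ▸ hlam0) hN0.le
  have hq : p * (1 - lam⁻¹) ≤ 1 := by
    have : 0 < lam⁻¹ := by positivity
    nlinarith
  have hpl : p * lam⁻¹ * N = 1 := by rw [mul_right_comm, hp, mul_inv_cancel₀ hlam0.ne']
  have h2 : (1 - p + p * lam⁻¹) ^ (N - 1) ≤ Real.exp 2 * Real.exp (-lam) := by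
    have h := one_sub_pow_le_exp hq (N - 1)
    rw [show 1 - p * (1 - lam⁻¹) = 1 - p + p * lam⁻¹ by ring] at h
    refine h.trans ?_
    rw [← Real.exp_add, Real.exp_le_exp, Nat.cast_sub hN1]
    have : 0 < p * lam⁻¹ := by positivity
    push_cast
    nlinarith
  have h3 : lam ^ k ≤ 2 ^ k * L ^ k := by
    rw [← mul_pow]
    exact pow_le_pow_left₀ hlam0.le hlam' k
  have h4 : Real.exp L * Real.exp (-lam) * L ^ k = ℓ / L := by
    rw [← hexp, pow_succ]
    field_simp
  calc _ ≤ Real.exp L * ((2 ^ k * L ^ k) * (Real.exp 2 * Real.exp (-lam))) := by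
        rw [inv_pow, inv_inv, hN]
        refine mul_le_mul_of_nonneg_left (mul_le_mul h3 h2 (pow_nonneg ?_ _) (by positivity))
          (Real.exp_pos _).le
        linarith
    _ = Real.exp 2 * 2 ^ k * (Real.exp L * Real.exp (-lam) * L ^ k) := by ring
    _ = _ := by rw [h4]

theorem smallDegree_bound {N D : ℕ} (hN : (N : ℝ) = Real.exp L) (hp : p * N = lam) (h1 : p ≤ 1)
    (hL : 1 ≤ L) (hlam : L ≤ lam) (hD : (D : ℝ) ≤ L / 40) :
    (Real.exp (-2) ^ (2 * D))⁻¹ * (1 - p + p * Real.exp (-2)) ^ (2 * N - 5) ≤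
      Real.exp (4 - 3 / 2 * L) := by
  have hN0 : (0 : ℝ) < N := hN ▸ Real.exp_pos L
  have hp0 : 0 < p := pos_of_mul_pos_left (hp ▸ by linarith) hN0.le
  have he : Real.exp (-2) < 1 / 5 := by
    rw [Real.exp_neg, inv_lt_comm₀ (Real.exp_pos _) (by norm_num)]
    have h := Real.exp_one_gt_d9
    rw [show (2 : ℝ) = 1 + 1 by norm_num, Real.exp_add]
    nlinarith
  have he0 := Real.exp_pos (-2)
  have h := one_sub_pow_le_exp (p := p * (1 - Real.exp (-2))) (by nlinarith) (2 * N - 5)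
  rw [show 1 - p * (1 - Real.exp (-2)) = 1 - p + p * Real.exp (-2) by ring] at h
  rw [← Real.exp_nat_mul, ← Real.exp_neg]
  refine (mul_le_mul_of_nonneg_left h (Real.exp_pos _).le).trans ?_
  rw [← Real.exp_add, Real.exp_le_exp]
  have h5 : (2 * N - 5 : ℝ) ≤ ((2 * N - 5 : ℕ) : ℝ) := by
    have : 2 * N ≤ (2 * N - 5) + 5 := by omega
    have : (2 * N : ℝ) ≤ ((2 * N - 5 : ℕ) : ℝ) + 5 := by exact_mod_cast this
    linarith
  have h6 : (2 * N - 5 : ℝ) * (p * (4 / 5)) ≤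
      ((2 * N - 5 : ℕ) : ℝ) * (p * (1 - Real.exp (-2))) := by
    refine (mul_le_mul_of_nonneg_right h5 (by positivity)).trans
      (mul_le_mul_of_nonneg_left ?_ (Nat.cast_nonneg _))
    nlinarith
  push_cast
  nlinarith

theorem smallAdj_bound {N D : ℕ} (hN : (N : ℝ) = Real.exp L) (hp : p * N = lam) (h1 : p ≤ 1)
    (hL : 1 ≤ L) (hlam : L ≤ lam) (hlam' : lam ≤ 2 * L) (hD : (D : ℝ) ≤ L / 40) :
    N ^ 2 * ((Real.exp (-2) ^ (2 * D))⁻¹ *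
      (p * (1 - p + p * Real.exp (-2)) ^ (2 * N - 5))) ≤ 4 * L ^ 2 * Real.exp (4 - L / 2) := by
  have h := smallDegree_bound hN hp h1 hL hlam hD
  have hN0 : (0 : ℝ) < N := hN ▸ Real.exp_pos L
  calc _ = lam * (N * ((Real.exp (-2) ^ (2 * D))⁻¹ *
        (1 - p + p * Real.exp (-2)) ^ (2 * N - 5))) := by rw [← hp]; ring
    _ ≤ (4 * L ^ 2) * (N * Real.exp (4 - 3 / 2 * L)) := by
        refine (mul_le_mul_of_nonneg_left (mul_le_mul_of_nonneg_left h hN0.le) ?_).trans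
          (mul_le_mul_of_nonneg_right ?_ (by positivity)) <;> nlinarith
    _ = _ := by
        rw [hN, ← Real.exp_add]
        ring_nf

theorem smallCommon_bound {N D : ℕ} (hN : (N : ℝ) = Real.exp L) (hp : p * N = lam) (h1 : p ≤ 1)
    (hL : 1 ≤ L) (hlam : L ≤ lam) (hlam' : lam ≤ 2 * L) (hD : (D : ℝ) ≤ L / 40) :
    N ^ 3 * ((Real.exp (-2) ^ (2 * D))⁻¹ *
      (p ^ 2 * (1 - p + p * Real.exp (-2)) ^ (2 * N - 5))) ≤
        4 * L ^ 2 * Real.exp (4 - L / 2) := by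
  have h := smallDegree_bound hN hp h1 hL hlam hD
  have hN0 : (0 : ℝ) < N := hN ▸ Real.exp_pos L
  calc _ = lam ^ 2 * (N * ((Real.exp (-2) ^ (2 * D))⁻¹ *
        (1 - p + p * Real.exp (-2)) ^ (2 * N - 5))) := by rw [← hp]; ring
    _ ≤ (4 * L ^ 2) * (N * Real.exp (4 - 3 / 2 * L)) := by
        refine (mul_le_mul_of_nonneg_left (mul_le_mul_of_nonneg_left h hN0.le) ?_).trans
          (mul_le_mul_of_nonneg_right ?_ (by positivity)) <;> nlinarith
    _ = _ := by
        rw [hN, ← Real.exp_add]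
        ring_nf

theorem dense_exponent_bound {N C D s : ℕ} {Y σ : ℝ} (hN : (N : ℝ) = Real.exp L)
    (hp : p * N = lam) (hL : 1 ≤ L) (hlam : L ≤ lam) (hlam' : lam ≤ 2 * L) (hD : L / 80 ≤ D)
    (hY : Y = 480 * (C + 1)) (hσ : σ = Real.exp (-Y) / (4 * (C + 1))) (hs : (s : ℝ) ≤ 2 * σ * N) :
    p * Real.exp Y * ((C + 1) * s : ℕ) ≤ Y * D / (2 * (C + 1)) - 2 * L := by
  have hN0 : (0 : ℝ) < N := hN ▸ Real.exp_pos L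
  have hp0 : 0 < p := pos_of_mul_pos_left (hp ▸ by linarith) hN0.le
  have h1 : Y * D / (2 * (C + 1)) = 240 * D := by
    rw [hY]
    field_simp
    ring
  have h2 : p * Real.exp Y * ((C + 1) * (2 * σ * N)) = lam / 2 := by
    rw [hσ, ← hp, Real.exp_neg]
    field_simp
    norm_num
  rw [h1]
  push_cast
  have h3 : p * Real.exp Y * ((C + 1) * s) ≤ lam / 2 := by
    rw [← h2]
    gcongr
  linarith

theorem dense_bound {N : ℕ} (hN : (N : ℝ) = Real.exp L) :
    (1 + Real.exp (-(2 * L))) ^ N - 1 ≤ Real.exp (Real.exp (-L)) - 1 := by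
  have h := Real.add_one_le_exp (Real.exp (-(2 * L)))
  refine sub_le_sub_right ((pow_le_pow_left₀ (by positivity) (by linarith) N).trans ?_) 1
  rw [← Real.exp_nat_mul, hN, ← Real.exp_add]
  ring_nf
  exact le_rfl

theorem unjoined_bound {N s : ℕ} {σ : ℝ} (hN : (N : ℝ) = Real.exp L) (hp : p * N = lam)
    (h1 : p ≤ 1) (hL : 1 ≤ L) (hlam : L ≤ lam) (hσ : 0 < σ) (hs : σ * N ≤ s)
    (hσL : 3 ≤ σ ^ 2 * L) :
    4 ^ N * (1 - p) ^ s ^ 2 ≤ Real.exp (-L) := by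
  have hN0 : (0 : ℝ) < N := hN ▸ Real.exp_pos L
  have hp0 : 0 < p := pos_of_mul_pos_left (hp ▸ by linarith) hN0.le
  have h4 : (4 : ℝ) ≤ Real.exp 2 := by
    have h := Real.exp_one_gt_d9
    rw [show (2 : ℝ) = 1 + 1 by norm_num, Real.exp_add]
    nlinarith
  have h5 : 3 * (N : ℝ) ≤ (s ^ 2 : ℕ) * p := by
    have h6 : (σ * N) ^ 2 ≤ (s : ℝ) ^ 2 := pow_le_pow_left₀ (by positivity) hs 2
    push_cast
    calc 3 * (N : ℝ) ≤ σ ^ 2 * lam * N := by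
          gcongr
          nlinarith
      _ = (σ * N) ^ 2 * p := by rw [← hp]; ring
      _ ≤ _ := by gcongr
  calc (4 : ℝ) ^ N * (1 - p) ^ s ^ 2 ≤ Real.exp 2 ^ N * Real.exp (-((s ^ 2 : ℕ) * p)) :=
        mul_le_mul (pow_le_pow_left₀ (by norm_num) h4 N) (one_sub_pow_le_exp h1 _)
          (pow_nonneg (by linarith) _) (by positivity)
    _ ≤ _ := by
        rw [← Real.exp_nat_mul, ← Real.exp_add, Real.exp_le_exp]
        have := Real.add_one_le_exp L
        linarith

theorem le_one_sub_pow (h1 : p ≤ 1 / 2) (N : ℕ) :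
    Real.exp (-(N * p) - 2 * (N * p ^ 2)) ≤ (1 - p) ^ N := by
  have hp : 0 < 1 - p := by linarith
  have h := Real.add_one_le_exp (p + 2 * p ^ 2)
  have h2 : Real.exp (-(p + 2 * p ^ 2)) ≤ 1 - p := by
    rw [Real.exp_neg, inv_le_comm₀ (Real.exp_pos _) hp]
    refine le_trans ?_ h
    rw [inv_le_iff_one_le_mul₀ hp]
    nlinarith [mul_nonneg (sq_nonneg p) (by linarith : 0 ≤ 1 - 2 * p)]
  calc _ = Real.exp (-(p + 2 * p ^ 2)) ^ N := by
        rw [← Real.exp_nat_mul]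
        ring_nf
    _ ≤ _ := pow_le_pow_left₀ (Real.exp_pos _).le h2 N

theorem largeDegree_bound {k : ℕ} (hN : (Fintype.card V : ℝ) = Real.exp L)
    (hp : p * Fintype.card V = lam) (h1 : p ≤ 1 / 2) (hL : 1 ≤ L) (hlam : L ≤ lam)
    (hlam' : lam ≤ 2 * L) (hNk : 4 * (k + 1) ≤ Fintype.card V) (hN2 : 2 * lam * p ≤ 1)
    (hℓ : 0 < ℓ) (hexp : Real.exp L * Real.exp (-lam) * L ^ (k + 1) = ℓ) :
    graphProb p (fun G : SimpleGraph V => ∀ v, k + 1 < G.degree v) ≤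
      Real.exp 1 * 4 ^ (k + 2) * (k + 1).factorial * ℓ⁻¹ + 4 * L * Real.exp (-L) := by
  set N := Fintype.card V with hNdef
  have hN0 : (0 : ℝ) < N := hN ▸ Real.exp_pos L
  have hp0 : 0 < p := pos_of_mul_pos_left (hp ▸ by linarith) hN0.le
  have hq : 0 < 1 - p := by linarith
  obtain ⟨W, hW⟩ : ∃ W : Finset V, W.card = N / 2 := by
    obtain ⟨W, -, hW⟩ := Finset.exists_subset_card_eq (s := (Finset.univ : Finset V)) (n := N / 2)
      (by rw [Finset.card_univ]; omega)
    exact ⟨W, hW⟩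
  have hWc : Wᶜ.card = N - N / 2 := by rw [Finset.card_compl, hW]
  refine (graphProb_forall_lt_degree_le hp0 (by linarith) W (k + 1)
    (Finset.card_pos.1 (by omega)) (by omega)).trans (add_le_add ?_ ?_)
  · have h4 : (N : ℝ) / 4 ≤ W.card := by
      rw [div_le_iff₀ (by norm_num)]
      exact_mod_cast (by omega : N ≤ W.card * 4)
    have h5 : ((N : ℝ) / 4) ^ (k + 1) / (k + 1).factorial ≤ Wᶜ.card.choose (k + 1) := by
      refine le_trans ?_ (Nat.pow_le_choose (k + 1) Wᶜ.card)
      gcongr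
      rw [div_le_iff₀ (by norm_num)]
      exact_mod_cast (by omega : N ≤ (Wᶜ.card + 1 - (k + 1)) * 4)
    have h6 : Real.exp (-lam) * Real.exp (-1) ≤ (1 - p) ^ (N - 1 - (k + 1)) := by
      refine le_trans ?_ ((le_one_sub_pow h1 N).trans
        (pow_le_pow_of_le_one hq.le (by linarith) (by omega)))
      rw [← Real.exp_add, Real.exp_le_exp]
      nlinarith
    rw [one_div]
    have h7 : ℓ / (Real.exp 1 * 4 ^ (k + 2) * (k + 1).factorial) ≤
        (W.card * Wᶜ.card.choose (k + 1) : ℕ) * (p ^ (k + 1) * (1 - p) ^ (N - 1 - (k + 1))) := by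
      calc _ = (N / 4 * ((N / 4) ^ (k + 1) / (k + 1).factorial)) *
            ((L / N) ^ (k + 1) * (Real.exp (-lam) * Real.exp (-1))) := by
            rw [← hexp, ← hN, Real.exp_neg 1, div_pow, div_pow]
            field_simp
            ring
        _ ≤ _ := by
            push_cast
            gcongr
            rw [div_le_iff₀ hN0, hp]
            exact hlam
    refine (inv_anti₀ (by positivity) h7).trans_eq ?_
    rw [inv_div, div_eq_mul_inv]
  · have h8 : p * Real.exp L ≤ 2 * L := by
      rw [← hN, hp]
      exact hlam'
    have h9 : p ≤ 2 * L * Real.exp (-L) := by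
      rwa [Real.exp_neg, ← div_eq_mul_inv, le_div_iff₀ (Real.exp_pos L)]
    rw [div_le_iff₀ hq]
    nlinarith [Real.exp_pos (-L)]

end Bounds

section Asymptotic

theorem graphProb_bounds_ge {V : Type*} [Fintype V] {p L lam : ℝ} {k C : ℕ} (hk : 1 ≤ k)
    (hC : C = 6 * k + 5) {Y σ : ℝ} (hY : Y = 480 * (C + 1))
    (hσ : σ = Real.exp (-Y) / (4 * (C + 1)))
    (hN : (Fintype.card V : ℝ) = Real.exp L) (hp : p * Fintype.card V = lam) (hL : 160 ≤ L)
    (hLk : 80 * (3 * k + 4) ≤ L) (hσL : 3 ≤ σ ^ 2 * L) (hσN : 1 ≤ σ * Real.exp L)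
    (hlam : L ≤ lam) (hlam' : lam ≤ 2 * L) (hL2 : 8 * L ^ 2 ≤ Real.exp L)
    (hℓ : 0 < Real.log L)
    (hexp : Real.exp L * Real.exp (-lam) * L ^ (k + 1) = Real.log L) :
    1 - (Real.exp 2 * 2 ^ k * (Real.log L / L) +
      (4 * L ^ 2 * Real.exp (4 - L / 2) + (4 * L ^ 2 * Real.exp (4 - L / 2) +
      ((Real.exp (Real.exp (-L)) - 1) + (Real.exp (-L) +
      (Real.exp 1 * 4 ^ (k + 2) * (k + 1).factorial * (Real.log L)⁻¹ +
        4 * L * Real.exp (-L))))))) ≤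
    graphProb p (fun G : SimpleGraph V =>
      k ≤ genKappa 3 G ∧ genKappa 3 G ≤ genLambda 3 G ∧ genLambda 3 G ≤ k + 1) := by
  have hL1 : 1 ≤ L := by linarith
  have hN0 : (0 : ℝ) < Fintype.card V := hN ▸ Real.exp_pos L
  have hp0 : 0 ≤ p := (pos_of_mul_pos_left (hp ▸ by linarith) hN0.le).le
  have hLN : 80 * (3 * k + 4) ≤ Fintype.card V := by
    have : (80 * (3 * k + 4) : ℝ) ≤ Fintype.card V := by
      have := Real.add_one_le_exp L
      linarith
    exact_mod_cast this
  have hp2 : 2 * lam * p ≤ 1 := by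
    refine le_of_mul_le_mul_right ?_ hN0
    rw [mul_assoc, hp, hN]
    nlinarith
  have hp1 : p ≤ 1 / 2 := by nlinarith
  have hp1' : p ≤ 1 := by linarith
  have hD : ((⌊L / 40⌋₊ : ℕ) : ℝ) ≤ L / 40 := Nat.floor_le (by linarith)
  have hD' : L / 80 ≤ (⌊L / 40⌋₊ : ℕ) := by
    have := Nat.lt_floor_add_one (L / 40)
    linarith
  have hDk : 3 * k + 4 ≤ ⌊L / 40⌋₊ := by
    refine Nat.le_floor ?_
    push_cast
    linarith
  have hσ0 : 0 < σ := by
    rw [hσ]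
    positivity
  have hs := Nat.le_ceil (σ * Fintype.card V)
  have hs' : (⌈σ * Fintype.card V⌉₊ : ℝ) ≤ 2 * σ * Fintype.card V := by
    have := Nat.ceil_lt_add_one (a := σ * Fintype.card V) (by positivity)
    rw [← hN] at hσN
    linarith
  have hs1 : 1 ≤ ⌈σ * Fintype.card V⌉₊ := Nat.ceil_pos.2 (by positivity)
  have hY0 : 0 ≤ Y := by
    rw [hY]
    positivity
  have hx1 : lam⁻¹ ≤ 1 := inv_le_one_of_one_le₀ (by linarith)
  have he1 : Real.exp (-2) ≤ 1 := Real.exp_le_one_iff.2 (by norm_num)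
  have h := one_le_graphProb_bounds_add (V := V) hp0 hp1' (by omega) hk hC.ge hs1 hDk
  rw [sub_le_iff_le_add]
  refine h.trans (add_le_add_right ?_ _)
  refine add_le_add ?_ (add_le_add ?_ (add_le_add ?_ (add_le_add ?_ (add_le_add ?_ ?_))))
  · exact (graphProb_exists_degree_le hp0 hp1' k (inv_pos.2 (by linarith)) hx1).trans
      (minDegree_bound hN hp hp1' hL1 hlam hlam' hexp)
  · exact (graphProb_exists_small_adj hp0 hp1' (Real.exp_pos _) he1 _).trans
      (smallAdj_bound hN hp hp1' hL1 hlam hlam' hD)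
  · exact (graphProb_exists_small_common hp0 hp1' (Real.exp_pos _) he1 _).trans
      (smallCommon_bound hN hp hp1' hL1 hlam hlam' hD)
  · exact (graphProb_exists_dense hp0 hp1' C _ _ hY0
      (dense_exponent_bound hN hp hL1 hlam hlam' hD' hY hσ hs')).trans (dense_bound hN)
  · exact (graphProb_exists_unjoined hp0 hp1' _).trans
      (unjoined_bound hN hp hp1' hL1 hlam hσ0 hs hσL)
  · exact largeDegree_bound hN hp hp1 hL1 hlam hlam' (by omega) hp2 hℓ hexp

theorem tendsto_error_bound (a b : ℝ) :
    Tendsto (fun L : ℝ => 1 - (a * (Real.log L / L) +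
      (4 * L ^ 2 * Real.exp (4 - L / 2) + (4 * L ^ 2 * Real.exp (4 - L / 2) +
      ((Real.exp (Real.exp (-L)) - 1) + (Real.exp (-L) + (b * (Real.log L)⁻¹ +
        4 * L * Real.exp (-L)))))))) atTop (nhds 1) := by
  have h1 : Tendsto (fun L : ℝ => a * (Real.log L / L)) atTop (nhds 0) := by
    simpa using Real.isLittleO_log_id_atTop.tendsto_div_nhds_zero.const_mul a
  have h2 : Tendsto (fun L : ℝ => 4 * L ^ 2 * Real.exp (4 - L / 2)) atTop (nhds 0) := by
    have h := ((Real.tendsto_pow_mul_exp_neg_atTop_nhds_zero 2).comp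
      (tendsto_id.atTop_div_const (two_pos (α := ℝ)))).const_mul (16 * Real.exp 4)
    rw [mul_zero] at h
    refine h.congr fun L => ?_
    simp only [Function.comp_apply, id]
    rw [sub_eq_add_neg, Real.exp_add]
    ring
  have h3 : Tendsto (fun L : ℝ => Real.exp (-L)) atTop (nhds 0) :=
    Real.tendsto_exp_neg_atTop_nhds_zero
  have h4 : Tendsto (fun L : ℝ => Real.exp (Real.exp (-L)) - 1) atTop (nhds 0) := by
    simpa using (Real.continuous_exp.tendsto 0 |>.comp h3).sub_const 1
  have h5 : Tendsto (fun L : ℝ => b * (Real.log L)⁻¹) atTop (nhds 0) := by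
    simpa using (tendsto_inv_atTop_zero.comp Real.tendsto_log_atTop).const_mul b
  have h6 : Tendsto (fun L : ℝ => 4 * L * Real.exp (-L)) atTop (nhds 0) := by
    have h := (Real.tendsto_pow_mul_exp_neg_atTop_nhds_zero 1).const_mul 4
    simpa [mul_assoc] using h
  simpa using tendsto_const_nhds.sub
    (h1.add (h2.add (h2.add (h4.add (h3.add (h5.add h6))))))

theorem eventually_threshold_bounds (k : ℕ) :
    ∀ᶠ L : ℝ in atTop, 1 < Real.log L ∧
      L ≤ L + ((k : ℝ) + 1) * Real.log L - Real.log (Real.log L) ∧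
      L + ((k : ℝ) + 1) * Real.log L - Real.log (Real.log L) ≤ 2 * L := by
  have h := (Real.isLittleO_log_id_atTop.bound (c := 1 / ((k : ℝ) + 1)) (by positivity))
  filter_upwards [h, Real.tendsto_log_atTop.eventually_gt_atTop 1, eventually_gt_atTop 0]
    with L h1 h2 h3
  rw [id, Real.norm_of_nonneg h3.le, Real.norm_of_nonneg (by linarith), one_div,
    ← div_eq_inv_mul, le_div_iff₀ (by positivity)] at h1
  have h4 := Real.log_nonneg h2.le
  have h5 := Real.log_le_self (by linarith : 0 ≤ Real.log L)
  refine ⟨h2, ?_, by linarith⟩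
  have : 0 ≤ (k : ℝ) * Real.log L := by positivity
  linarith

theorem exp_threshold (k : ℕ) {L : ℝ} (hL : 0 < L) (hℓ : 0 < Real.log L) :
    Real.exp L * Real.exp (-(L + ((k : ℝ) + 1) * Real.log L - Real.log (Real.log L))) *
      L ^ (k + 1) = Real.log L := by
  have h : L ^ (k + 1) = Real.exp (((k : ℝ) + 1) * Real.log L) := by
    rw [← Nat.cast_succ, Real.exp_nat_mul, Real.exp_log hL]
  rw [h, ← Real.exp_add, ← Real.exp_add]
  ring_nf
  exact Real.exp_log hℓ

end Asymptotic

/-- Almost surely `k ≤ κ₃(G(n,p)) ≤ λ₃(G(n,p)) ≤ k + 1` for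
`p(n) = (log n + (k+1) log log n − log log log n)/n`. -/
theorem genKappa_genLambda_bounds_as (k : ℕ) (hk : 1 ≤ k) :
    Tendsto (fun n : ℕ =>
      gnpProb n ((Real.log n + ((k : ℝ) + 1) * Real.log (Real.log n) -
          Real.log (Real.log (Real.log n))) / n)
        {G : SimpleGraph (Fin n) |
          k ≤ genKappa 3 G ∧ genKappa 3 G ≤ genLambda 3 G ∧ genLambda 3 G ≤ k + 1})
      atTop (nhds 1) := by
  have hlog : Tendsto (fun n : ℕ => Real.log n) atTop atTop :=
    Real.tendsto_log_atTop.comp tendsto_natCast_atTop_atTop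
  obtain ⟨C, hC⟩ : ∃ C, C = 6 * k + 5 := ⟨_, rfl⟩
  obtain ⟨Y, hY⟩ : ∃ Y : ℝ, Y = 480 * (C + 1) := ⟨_, rfl⟩
  obtain ⟨σ, hσ⟩ : ∃ σ : ℝ, σ = Real.exp (-Y) / (4 * (C + 1)) := ⟨_, rfl⟩
  have hσ0 : 0 < σ := by
    rw [hσ]
    positivity
  have hsq : ∀ᶠ L : ℝ in atTop, 8 * L ^ 2 ≤ Real.exp L := by
    have h := (Real.tendsto_pow_mul_exp_neg_atTop_nhds_zero 2).const_mul 8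
    rw [mul_zero] at h
    filter_upwards [h.eventually_le_const one_pos] with L hL
    rwa [Real.exp_neg, ← mul_assoc, ← div_eq_mul_inv, div_le_one (Real.exp_pos L)] at hL
  refine tendsto_of_tendsto_of_tendsto_of_le_of_le'
    ((tendsto_error_bound (Real.exp 2 * 2 ^ k)
      (Real.exp 1 * 4 ^ (k + 2) * (k + 1).factorial)).comp hlog) tendsto_const_nhds ?_ ?_
  · filter_upwards [hlog.eventually (eventually_threshold_bounds k), hlog.eventually hsq,
      hlog.eventually_ge_atTop 160, hlog.eventually_ge_atTop (80 * (3 * k + 4)),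
      hlog.eventually ((tendsto_id.const_mul_atTop (pow_pos hσ0 2)).eventually_ge_atTop 3),
      hlog.eventually ((Real.tendsto_exp_atTop.const_mul_atTop hσ0).eventually_ge_atTop 1),
      eventually_gt_atTop 0] with n ⟨h1, h2, h3⟩ h4 h5 h6 h7 h8 hn
    have hn' : (0 : ℝ) < n := by exact_mod_cast hn
    rw [gnpProb_eq_graphProb]
    exact graphProb_bounds_ge (V := Fin n) hk hC hY hσ (by rw [Fintype.card_fin, Real.exp_log hn'])
      (by rw [Fintype.card_fin, div_mul_cancel₀ _ hn'.ne']) h5 h6 h7 h8 h2 h3 h4 (by linarith)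
      (exp_threshold k (by linarith) (by linarith))
  · filter_upwards [hlog.eventually (eventually_threshold_bounds k), hlog.eventually hsq,
      hlog.eventually_ge_atTop 160, eventually_gt_atTop 0] with n ⟨h1, h2, h3⟩ h4 h5 hn
    have hn' : (0 : ℝ) < n := by exact_mod_cast hn
    rw [Real.exp_log hn'] at h4
    rw [gnpProb_eq_graphProb]
    refine graphProb_le_one (div_nonneg (by linarith) hn'.le) ?_ _
    rw [div_le_one hn']
    nlinarith
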